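/- arXiv:1011.5201 — 4 statements merged into one kernel-verified Lean document; each statement's English description precedes it below -/
import Mathlib

section
/- (Theorem 1.1, orthogonal case.) The ideal K_∞ of free relations for matrix O(n)-invariants is zero: if f ∈ N_σ satisfies Ψ_n(f) = 0 for every n ≥ 1, then f = 0. -/
/-! Statement 0: (Theorem 1.1, orthogonal case.) The ideal of free relations for
matrix `O(n)`-invariants is zero. -/

open scoped BigOperators
open Matrix

/-- Letters of the monoid `M`: `(k, false)` is `x_k` and `(k, true)` is `x_k^T`. -/
abbrev OLetter (d : ℕ) := Fin d × Bool

/-- The involution `τ` on letters: `x_k ↦ x_k^T`, `x_k^T ↦ x_k`. -/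
def oTau {d : ℕ} (l : OLetter d) : OLetter d := (l.1, !l.2)

/-- The transpose of a word: reverse it and apply the involution to each letter. -/
def wordT {A : Type*} (τ : A → A) (w : List A) : List A := (w.reverse).map τ

/-- The `m`-th power `e^m` of a word `e` (concatenation of `m` copies). -/
def wpow {A : Type*} (e : List A) (m : ℕ) : List A := (List.replicate m e).flatten

/-- A word is primitive if it is nonempty and is not a power `e^m` with `m ≥ 2`. -/
def WPrimitive {A : Type*} (w : List A) : Prop :=
  w ≠ [] ∧ ∀ (e : List A) (m : ℕ), 2 ≤ m → w ≠ wpow e m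

/-- `a ∼ b`: `b` is a cyclic permutation of `a` or of `a^T`. -/
def simRel {A : Type*} (τ : A → A) (a b : List A) : Prop :=
  List.IsRotated a b ∨ List.IsRotated a (wordT τ b)

/-- The set `N` of primitive words in the letters `x_1, …, x_d, x_1^T, …, x_d^T`. -/
def PrimWord (d : ℕ) := {w : List (OLetter d) // WPrimitive w}

/-- `∼`-equivalence classes of primitive words. -/
def WCls (d : ℕ) := Quot (fun a b : PrimWord d => simRel oTau a.1 b.1)

/-- The polynomial algebra `N_σ` on indeterminates `σ_t(ā)`, `t ≥ 1`,
`ā` a `∼`-class of primitive words. -/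
abbrev Nsigma (F : Type*) [CommSemiring F] (d : ℕ) := MvPolynomial (ℕ+ × WCls d) F

/-- `σ_t(A)`: the coefficient of `λ^{n-t}` in `det(A + λE)`. -/
noncomputable def msigma {R : Type*} [CommRing R] {ι : Type*} [Fintype ι] [DecidableEq ι]
    (t : ℕ) (A : Matrix ι ι R) : R :=
  ((A.map Polynomial.C + (Polynomial.X : Polynomial R) • 1).det).coeff (Fintype.card ι - t)

/-- The coordinate ring `R_n = F[x_{ij}(k)]`. -/
abbrev Rmat (F : Type*) [CommSemiring F] (n d : ℕ) := MvPolynomial (Fin n × Fin n × Fin d) F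

/-- The generic `n × n` matrix `X_k`. -/
noncomputable def genX (F : Type*) [CommSemiring F] (n d : ℕ) (k : Fin d) :
    Matrix (Fin n) (Fin n) (Rmat F n d) :=
  Matrix.of fun i j => MvPolynomial.X (i, j, k)

/-- The matrix of a letter: `X_k` for `x_k` and `X_kᵀ` for `x_k^T` (orthogonal case). -/
noncomputable def oLetterMat (F : Type*) [CommSemiring F] (n d : ℕ) (l : OLetter d) :
    Matrix (Fin n) (Fin n) (Rmat F n d) :=
  if l.2 then (genX F n d l.1)ᵀ else genX F n d l.1

/-- The matrix `X_a` of a word `a = a_1 ⋯ a_r`. -/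
noncomputable def oWordMat (F : Type*) [CommSemiring F] (n d : ℕ) (w : List (OLetter d)) :
    Matrix (Fin n) (Fin n) (Rmat F n d) :=
  (w.map (oLetterMat F n d)).prod

/-- The evaluation homomorphism `Ψ_n : N_σ → R_n`, sending `σ_t(ā)` to `σ_t(X_a)` if
`t ≤ n` and to `0` otherwise (it does not depend on the representative of `ā`). -/
noncomputable def PsiO (F : Type*) [Field F] (n d : ℕ) : Nsigma F d →ₐ[F] Rmat F n d :=
  MvPolynomial.aeval fun v : ℕ+ × WCls d =>
    if (v.1 : ℕ) ≤ n then msigma v.1 (oWordMat F n d (Quot.out v.2).1) else 0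


namespace FR
open Polynomial

section words
variable {L : Type*}

theorem wpow_succ (e : List L) (m : ℕ) : wpow e (m+1) = e ++ wpow e m := by
  simp [wpow, List.replicate_succ]

theorem wpow_range (W : ℕ → L) (g : ℕ) (h : ∀ k, W (g + k) = W k) (m : ℕ) :
    wpow ((List.range g).map W) m = (List.range (g*m)).map W := by
  induction m with
  | zero => simp [wpow]
  | succ m ih =>
    rw [wpow_succ, ih, mul_add, mul_one, add_comm, List.range_add, List.map_append, List.map_map]
    congr 1
    apply List.map_congr_left
    intro k _
    simp [h]

/-- cyclic letter function -/
def cyc (a : List L) (ha : a ≠ []) (i : ZMod a.length) : L :=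
  haveI : NeZero a.length := ⟨by simpa using ha⟩
  a[i.val]'(ZMod.val_lt i)

theorem cyc_range (a : List L) (ha : a ≠ []) (i : ZMod a.length) :
    (List.range a.length).map (fun k => cyc a ha (i + (k:ℕ))) = a.rotate i.val := by
  have : NeZero a.length := ⟨by simpa using ha⟩
  apply List.ext_getElem
  · simp
  · intro k h1 h2
    simp only [List.getElem_map, List.getElem_range, List.getElem_rotate, cyc]
    congr 1
    rw [ZMod.val_add, ZMod.val_natCast, add_comm]
    simp

theorem cyc_range0 (a : List L) (ha : a ≠ []) :
    (List.range a.length).map (fun k => cyc a ha (k:ℕ)) = a := by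
  have : NeZero a.length := ⟨by simpa using ha⟩
  simpa using cyc_range a ha 0

theorem prim_period (a : List L) (hp : WPrimitive a) (h : ZMod a.length)
    (hh : ∀ j, cyc a hp.1 (j + h) = cyc a hp.1 j) : h = 0 := by
  have : NeZero a.length := ⟨by simpa using hp.1⟩
  have hu : ∀ u : ℕ, ∀ j, cyc a hp.1 (j + u * h) = cyc a hp.1 j := by
    intro u
    induction u with
    | zero => simp
    | succ u ih =>
      intro j
      rw [Nat.cast_succ, add_mul, one_mul, ← add_assoc, hh, ih]
  have hr0 : 0 < a.length := Nat.pos_of_ne_zero (NeZero.ne a.length)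
  obtain ⟨g, hg⟩ : ∃ g, g = Nat.gcd h.val a.length := ⟨_, rfl⟩
  have hg0 : 0 < g := hg ▸ Nat.gcd_pos_of_pos_right _ hr0
  have hgr : g ∣ a.length := hg ▸ Nat.gcd_dvd_right _ _
  obtain ⟨u, hu'⟩ : ∃ u : ℕ, (g : ZMod a.length) = u * h := by
    have := Nat.gcd_eq_gcd_ab h.val a.length
    have h2 := congrArg (Int.cast : ℤ → ZMod a.length) this
    push_cast at h2
    rw [ZMod.natCast_self, zero_mul, add_zero, ZMod.natCast_zmod_val] at h2
    refine ⟨(((Nat.gcdA h.val a.length : ℤ)) : ZMod a.length).val, ?_⟩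
    rw [ZMod.natCast_zmod_val, hg, h2, mul_comm]
  have hgp : ∀ j, cyc a hp.1 (j + g) = cyc a hp.1 j := by
    intro j; rw [hu']; exact hu u j
  obtain ⟨m, hm⟩ := hgr
  have e1 := wpow_range (fun k : ℕ => cyc a hp.1 (k : ZMod a.length)) g (by
    intro k
    rw [Nat.cast_add, add_comm]; exact hgp _) m
  rw [← hm, cyc_range0] at e1
  have hm1 : ¬ 2 ≤ m := fun h2 => hp.2 _ m h2 e1.symm
  have : m = 1 := by
    rcases m with _ | _ | m
    · omega
    · rfl
    · omega
  rw [this, mul_one] at hm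
  have : a.length ∣ h.val := (Dvd.intro_left 1 (by rw [one_mul]; exact hm.trans hg)).trans (Nat.gcd_dvd_left h.val a.length)
  have h3 := (ZMod.natCast_eq_zero_iff h.val a.length).2 this
  rwa [ZMod.natCast_zmod_val] at h3

/-- `b` can be read from position `i` on the cycle of `a`. -/
def reads (a : List L) (ha : a ≠ []) : List L → ZMod a.length → Prop
  | [], _ => True
  | l :: b, i => l = cyc a ha i ∧ reads a ha b (i + 1)

theorem reads_iff (a : List L) (ha : a ≠ []) (b : List L) (i : ZMod a.length) :
    reads a ha b i ↔ b = (List.range b.length).map (fun k => cyc a ha (i + (k:ℕ))) := by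
  induction b generalizing i with
  | nil => simp [reads]
  | cons l b ih =>
    rw [reads, ih, List.length_cons, List.range_succ_eq_map, List.map_cons, List.map_map,
      List.cons.injEq]
    simp only [Nat.cast_zero, add_zero]
    have : ((fun k : ℕ => cyc a ha (i + (k:ℕ))) ∘ Nat.succ) =
        fun k : ℕ => cyc a ha (i + 1 + (k:ℕ)) := by
      funext k
      simp only [Function.comp, Nat.succ_eq_add_one, Nat.cast_add, Nat.cast_one]
      congr 1; ring
    rw [this]

theorem reads_rotate (a : List L) (ha : a ≠ []) (b : List L) (i : ZMod a.length)
    (hl : b.length = a.length) : reads a ha b i ↔ b = a.rotate i.val := by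
  rw [reads_iff, hl, cyc_range]

theorem reads_unique (a : List L) (hp : WPrimitive a) (b : List L)
    (hb : List.IsRotated b a) : ∃ i, ∀ j, reads a hp.1 b j ↔ j = i := by
  have : NeZero a.length := ⟨by simpa using hp.1⟩
  obtain ⟨n, hn⟩ := hb.symm
  have hl : b.length = a.length := hb.perm.length_eq
  refine ⟨(n : ZMod a.length), fun j => ?_⟩
  have h1 : reads a hp.1 b (n : ZMod a.length) := by
    rw [reads_rotate _ _ _ _ hl, ZMod.val_natCast, List.rotate_mod, hn]
  constructor
  · intro hj
    rw [reads_iff, hl] at h1 hj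
    have h2 := h1.symm.trans hj
    rw [List.map_inj_left] at h2
    have h3 : ∀ k : ZMod a.length, cyc a hp.1 ((n : ZMod a.length) + k) = cyc a hp.1 (j + k) := by
      intro k
      have := h2 k.val (List.mem_range.2 (ZMod.val_lt k))
      simpa using this
    have := prim_period a hp (j - n) (by
      intro k
      have := h3 (k - n)
      rw [show (n : ZMod a.length) + (k - n) = k by ring] at this
      rw [this]; congr 1; ring)
    exact sub_eq_zero.1 this
  · rintro rfl; exact h1

theorem reads_wpow (a b : List L) (hp : WPrimitive a) (hb : WPrimitive b) (i : ZMod a.length)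
    (h : reads a hp.1 (wpow b a.length) i) : List.IsRotated b a := by
  have : NeZero a.length := ⟨by simpa using hp.1⟩
  have : NeZero b.length := ⟨by simpa using hb.1⟩
  have e1 := wpow_range (fun k : ℕ => cyc b hb.1 (k : ZMod b.length)) b.length (by
    intro k; simp) a.length
  rw [cyc_range0] at e1
  have hlen : (wpow b a.length).length = b.length * a.length := by rw [e1]; simp
  rw [reads_iff, hlen, e1, List.map_inj_left] at h
  have key : ∀ k : ℕ, cyc b hb.1 (k : ZMod b.length) = cyc a hp.1 (i + (k:ℕ)) := by
    intro k
    have := h (k % (b.length * a.length)) (List.mem_range.2 (Nat.mod_lt _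
      (Nat.mul_pos (NeZero.pos _) (NeZero.pos _))))
    have c1 : ((k % (b.length * a.length) : ℕ) : ZMod b.length) = k := by
      rw [ZMod.natCast_eq_natCast_iff]
      exact (Nat.mod_modEq k _).of_mul_right _
    have c2 : ((k % (b.length * a.length) : ℕ) : ZMod a.length) = k := by
      rw [ZMod.natCast_eq_natCast_iff]
      exact (Nat.mod_modEq k _).of_mul_left _
    rwa [c1, c2] at this
  have h1 : ((b.length : ℕ) : ZMod a.length) = 0 := by
    apply prim_period a hp
    intro j
    have k1 := key (j - i).val
    have k2 := key ((j - i).val + b.length)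
    simp only [Nat.cast_add, ZMod.natCast_self, add_zero, ZMod.natCast_zmod_val] at k1 k2
    rw [k1] at k2
    rw [show i + (j - i + (b.length : ZMod a.length)) = j + b.length by ring,
      show i + (j - i) = j by ring] at k2
    exact k2.symm
  have h2 : ((a.length : ℕ) : ZMod b.length) = 0 := by
    apply prim_period b hb
    intro j
    have k1 := key j.val
    have k2 := key (j.val + a.length)
    simp only [Nat.cast_add, ZMod.natCast_self, add_zero, ZMod.natCast_zmod_val] at k1 k2
    rw [k1, k2]
  rw [ZMod.natCast_eq_zero_iff] at h1 h2
  have hl := Nat.dvd_antisymm h2 h1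
  have : b = a.rotate i.val := by
    rw [← cyc_range a hp.1 i]
    conv_lhs => rw [← cyc_range0 b hb.1]
    have hl' : List.range a.length = List.range b.length := by rw [hl]
    refine Eq.trans ?_ (congrArg _ hl'.symm)
    apply List.map_congr_left
    intro k _
    exact key k
  rw [this]
  exact (List.IsRotated.forall a i.val)

theorem wordT_append (τ : L → L) (a b : List L) :
    wordT τ (a ++ b) = wordT τ b ++ wordT τ a := by simp [wordT]

theorem wordT_wordT (τ : L → L) (hτ : ∀ l, τ (τ l) = l) (a : List L) :
    wordT τ (wordT τ a) = a := by
  simp [wordT, Function.comp_def, hτ]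

theorem wpow_succ' (e : List L) (m : ℕ) : wpow e (m+1) = wpow e m ++ e := by
  simp [wpow, List.replicate_succ']

theorem wordT_wpow (τ : L → L) (e : List L) (m : ℕ) :
    wordT τ (wpow e m) = wpow (wordT τ e) m := by
  induction m with
  | zero => simp [wpow, wordT]
  | succ m ih => rw [wpow_succ, wordT_append, ih, wpow_succ']

theorem wordT_prim (τ : L → L) (hτ : ∀ l, τ (τ l) = l) (a : List L) (h : WPrimitive a) :
    WPrimitive (wordT τ a) := by
  refine ⟨by simpa [wordT] using h.1, fun e m hm he => h.2 (wordT τ e) m hm ?_⟩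
  rw [← wordT_wpow, ← he, wordT_wordT τ hτ]

end words

section mats
variable {K : Type*} [Field K]
variable {ι κ : Type*} [Fintype ι] [DecidableEq ι] [Fintype κ] [DecidableEq κ]

/-- `det (1 + λ A)`. -/
noncomputable def dd (A : Matrix ι ι K) : K[X] := (-A).charpolyRev

theorem dd_blocks (A : Matrix ι ι K) (D : Matrix κ κ K) :
    dd (Matrix.fromBlocks A 0 0 D) = dd A * dd D := by
  unfold dd
  rw [← Matrix.reverse_charpoly, ← Matrix.reverse_charpoly, ← Matrix.reverse_charpoly,
    Matrix.fromBlocks_neg, neg_zero, neg_zero, Matrix.charpoly_fromBlocks_zero₁₂,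
    Polynomial.reverse_mul_of_domain]

theorem dd_transpose (A : Matrix ι ι K) : dd Aᵀ = dd A := by
  unfold dd
  rw [← Matrix.reverse_charpoly, ← Matrix.reverse_charpoly, ← Matrix.transpose_neg,
    Matrix.charpoly_transpose]

theorem dd_reindex (e : ι ≃ κ) (A : Matrix ι ι K) : dd (Matrix.reindex e e A) = dd A := by
  unfold dd
  have : -(Matrix.reindex e e A) = Matrix.reindex e e (-A) := by ext; simp
  rw [← Matrix.reverse_charpoly, ← Matrix.reverse_charpoly, this, Matrix.charpoly_reindex]

theorem dd_conj (S S' A : Matrix ι ι K) (h : S' * S = 1) : dd (S * A * S') = dd A := by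
  unfold dd
  have h' : S * S' = 1 := mul_eq_one_comm.1 h
  have := Matrix.charpoly_units_conj (⟨S, S', h', h⟩ : (Matrix ι ι K)ˣ) (-A)
  rw [← Matrix.reverse_charpoly, ← Matrix.reverse_charpoly, ← this]
  rw [← Matrix.coe_units_inv]
  change _ = (S * -A * S').charpoly.reverse
  simp

theorem msigma_eq (t : ℕ) (A : Matrix ι ι K) :
    (if t ≤ Fintype.card ι then msigma t A else 0) = (dd A).coeff t := by
  have h1 : A.map Polynomial.C + (Polynomial.X : Polynomial K) • 1 = (-A).charmatrix := by
    ext i j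
    simp [Matrix.charmatrix_apply, Matrix.one_apply, Matrix.diagonal_apply, add_comm]
  unfold dd msigma
  rw [h1, ← Matrix.reverse_charpoly, Polynomial.coeff_reverse, Matrix.charpoly_natDegree_eq_dim]
  split_ifs with h
  · rw [Polynomial.revAt_le h]; rfl
  · rw [Polynomial.revAt_eq_self_of_lt (by omega), Polynomial.coeff_eq_zero_of_natDegree_lt]
    rw [Matrix.charpoly_natDegree_eq_dim]; omega

theorem msigma_map {R S : Type*} [CommRing R] [CommRing S] (φ : R →+* S) (t : ℕ)
    (A : Matrix ι ι R) : φ (msigma t A) = msigma t (A.map φ) := by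
  unfold msigma
  rw [← Polynomial.coeff_map, ← Polynomial.coe_mapRingHom, RingHom.map_det]
  congr 2
  ext i j : 1
  by_cases h : i = j
  · subst h; simp
  · simp [h]

theorem dd_nilp (A : Matrix ι ι K) (h : IsNilpotent A) : dd A = 1 := by
  have h1 : IsUnit (dd A) := Matrix.isUnit_charpolyRev_of_isNilpotent h.neg
  obtain ⟨c, hc, h2⟩ := Polynomial.isUnit_iff.1 h1
  have h3 : eval 0 (dd A) = 1 := Matrix.eval_charpolyRev
  rw [← h2] at h3 ⊢
  rw [eval_C] at h3; rw [h3, C_1]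

theorem dd_diag (v : ι → K) : dd (Matrix.diagonal v) = ∏ i, (1 + X * C (v i)) := by
  unfold dd Matrix.charpolyRev
  rw [← Matrix.det_diagonal]
  congr 1
  ext i j : 1
  by_cases h : i = j
  · subst h; simp
  · simp [h]

variable {L : Type*}

/-- Realizable families of polynomials. -/
def Rz (K : Type*) [Field K] {L : Type*} (P : List L → K[X]) : Prop :=
  ∃ (ι : Type) (_ : Fintype ι) (_ : DecidableEq ι) (_ : Nonempty ι) (Y : L → Matrix ι ι K),
    ∀ b, WPrimitive b → dd (b.map Y).prod = P b

theorem Rz.congr {P Q : List L → K[X]} (h : Rz K P) (e : ∀ b, WPrimitive b → P b = Q b) :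
    Rz K Q := by
  obtain ⟨ι, _, _, _, Y, hY⟩ := h
  exact ⟨ι, _, _, ‹_›, Y, fun b hb => (hY b hb).trans (e b hb)⟩

theorem prod_blocks {M : Type*} (l : List M) (Y : M → Matrix ι ι K) (Z : M → Matrix κ κ K) :
    (l.map (fun x => Matrix.fromBlocks (Y x) 0 0 (Z x))).prod =
      Matrix.fromBlocks (l.map Y).prod 0 0 (l.map Z).prod := by
  induction l with
  | nil => simp
  | cons a l ih => simp [ih, Matrix.fromBlocks_multiply]

theorem Rz.mul {P Q : List L → K[X]} (h : Rz K P) (h' : Rz K Q) :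
    Rz K (fun b => P b * Q b) := by
  obtain ⟨ι, _, _, _, Y, hY⟩ := h
  obtain ⟨κ, _, _, _, Z, hZ⟩ := h'
  refine ⟨ι ⊕ κ, inferInstance, inferInstance, inferInstance,
    fun x => Matrix.fromBlocks (Y x) 0 0 (Z x), fun b hb => ?_⟩
  rw [prod_blocks, dd_blocks, hY b hb, hZ b hb]

theorem Rz.one : Rz K (fun _ : List L => (1 : K[X])) := by
  refine ⟨Unit, inferInstance, inferInstance, inferInstance, fun _ => 0, fun b hb => ?_⟩
  apply dd_nilp
  rcases b with _ | ⟨x, b⟩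
  · exact absurd rfl hb.1
  · simp

theorem Rz.prod {α : Type*} (s : Finset α) (P : α → List L → K[X]) (h : ∀ a ∈ s, Rz K (P a)) :
    Rz K (fun b => ∏ a ∈ s, P a b) := by
  classical
  induction s using Finset.induction_on with
  | empty => simpa using Rz.one
  | insert a s ha ih =>
    simp only [Finset.prod_insert ha]
    exact (h a (by simp)).mul (ih fun b hb => h b (by simp [hb]))

open Classical in
/-- cycle matrices -/
noncomputable def cm (a : List L) (ha : a ≠ []) (ζ : K) (l : L) :
    Matrix (ZMod a.length) (ZMod a.length) K :=
  Matrix.of fun i j => if l = cyc a ha i ∧ j = i + 1 then ζ else 0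

open Classical in
theorem cm_word (a : List L) (ha : a ≠ []) [Fintype (ZMod a.length)] (ζ : K) (b : List L)
    (i j : ZMod a.length) :
    (b.map (cm a ha ζ)).prod i j =
      if reads a ha b i ∧ j = i + b.length then ζ ^ b.length else 0 := by
  induction b generalizing i with
  | nil => simp [reads, Matrix.one_apply, eq_comm]
  | cons l b ih =>
    rw [List.map_cons, List.prod_cons, Matrix.mul_apply, Finset.sum_eq_single (i + 1)]
    · rw [ih]
      simp only [cm, Matrix.of_apply, and_true, reads, List.length_cons, Nat.cast_add,
        Nat.cast_one]
      have : i + 1 + (b.length : ZMod a.length) = i + (b.length + 1) := by ring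
      rw [this]
      by_cases h1 : l = cyc a ha i <;> by_cases h2 : reads a ha b (i + 1) <;>
        by_cases h3 : j = i + (b.length + 1) <;> simp [h1, h2, h3, pow_succ, mul_comm]
    · intro k _ hk
      simp [cm, hk]
    · simp

theorem prod_wpow (Y : L → Matrix ι ι K) (b : List L) (m : ℕ) :
    ((wpow b m).map Y).prod = (b.map Y).prod ^ m := by
  induction m with
  | zero => simp [wpow]
  | succ m ih => rw [wpow_succ, List.map_append, List.prod_append, ih, pow_succ']

open Classical in
theorem Rz.cycle [IsAlgClosed K] (a : List L) (hp : WPrimitive a) (z : K) :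
    Rz K (fun b => if List.IsRotated b a then 1 + X * C z else 1) := by
  have : NeZero a.length := ⟨by simpa using hp.1⟩
  obtain ⟨ζ, hζ⟩ := IsAlgClosed.exists_pow_nat_eq z (NeZero.pos a.length)
  refine ⟨ZMod a.length, inferInstance, inferInstance, inferInstance, cm a hp.1 ζ,
    fun b hb => ?_⟩
  beta_reduce
  split_ifs with h
  · obtain ⟨i, hi⟩ := reads_unique a hp b h
    have hl : b.length = a.length := h.perm.length_eq
    have : (b.map (cm a hp.1 ζ)).prod = Matrix.diagonal (fun j => if j = i then z else 0) := by
      ext j k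
      rw [cm_word, hl, hζ, hi, Matrix.diagonal_apply]
      simp only [ZMod.natCast_self, add_zero]
      by_cases h1 : j = i <;> by_cases h2 : k = j <;> simp [h1, h2, eq_comm]
    rw [this, dd_diag, Finset.prod_eq_single i]
    · simp
    · intro k _ hk; simp [hk]
    · simp
  · apply dd_nilp
    refine ⟨a.length, ?_⟩
    rw [← prod_wpow]
    ext i j
    rw [cm_word, if_neg]
    · rfl
    · rintro ⟨h1, _⟩
      exact h (reads_wpow a b hp hb i h1)

open Classical in
theorem Rz.cycleE [IsAlgClosed K] (a : List L) (hp : WPrimitive a) (n : ℕ) (E : K[X])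
    (hn : E.natDegree = n) (hE : E.coeff 0 = 1) :
    Rz K (fun b => if List.IsRotated b a then E else 1) := by
  induction n generalizing E with
  | zero =>
    rw [Polynomial.eq_C_of_natDegree_eq_zero hn, hE]
    simpa using Rz.one
  | succ n ih =>
    obtain ⟨ρ, hρ⟩ := IsAlgClosed.exists_root E (by
      intro h0; rw [Polynomial.natDegree_eq_of_degree_eq_some (n := 0) h0] at hn; omega)
    obtain ⟨Q, hQ⟩ := Polynomial.dvd_iff_isRoot.2 hρ
    have hρ0 : ρ ≠ 0 := by
      rintro rfl
      rw [hQ] at hE; simp at hE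
    have hE' : E = (1 + X * C (-ρ⁻¹)) * (C (-ρ) * Q) := by
      have : C ρ⁻¹ * C ρ = (1 : K[X]) := by rw [← C_mul, inv_mul_cancel₀ hρ0, C_1]
      rw [hQ]
      simp only [C_neg]
      linear_combination (-X * Q) * this
    have hQ0 : Q ≠ 0 := by rintro rfl; simp [hQ] at hE
    refine ((Rz.cycle a hp (-ρ⁻¹)).mul (ih (C (-ρ) * Q) ?_ ?_)).congr ?_
    · rw [Polynomial.natDegree_C_mul (neg_ne_zero.2 hρ0)]
      rw [hQ, Polynomial.natDegree_mul (Polynomial.X_sub_C_ne_zero _) hQ0,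
        Polynomial.natDegree_X_sub_C] at hn
      omega
    · rw [hE', Polynomial.mul_coeff_zero] at hE
      simpa using hE
    · intro b _
      split_ifs
      · exact hE'.symm
      · simp

theorem sqrtE (h2 : (2 : K) ≠ 0) (c : ℕ → K) (T : ℕ) :
    ∃ E : K[X], E.coeff 0 = 1 ∧ ∀ t, 1 ≤ t → t ≤ T → (E * E).coeff t = c t := by
  induction T with
  | zero => exact ⟨1, by simp, fun t h1 h2 => by omega⟩
  | succ T ih =>
    obtain ⟨E, h0, hE⟩ := ih
    refine ⟨E + C ((c (T+1) - (E*E).coeff (T+1)) / 2) * X ^ (T+1), ?_, ?_⟩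
    · simp [h0]
    · intro t ht1 htT
      set e := (c (T+1) - (E*E).coeff (T+1)) / 2 with he
      have : (E + C e * X ^ (T+1)) * (E + C e * X ^ (T+1)) =
        E * E + (C (2 * e) * E) * X ^ (T+1) + (C (e * e) * X ^ (T + 1)) * X ^ (T+1) := by
        simp only [C_mul, map_ofNat]
        ring
      rw [this, coeff_add, coeff_add, coeff_mul_X_pow', coeff_mul_X_pow']
      rcases Nat.lt_or_ge t (T+1) with h | h
      · rw [if_neg (by omega), if_neg (by omega), hE t ht1 (by omega)]; simp
      · have : t = T + 1 := by omega
        subst this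
        simp [h0, he]
        field_simp
        ring

theorem plainE (c : ℕ → K) (T : ℕ) :
    ∃ E : K[X], E.coeff 0 = 1 ∧ ∀ t, 1 ≤ t → t ≤ T → E.coeff t = c t := by
  refine ⟨∑ t ∈ Finset.range (T+1), C (if t = 0 then 1 else c t) * X ^ t, ?_, ?_⟩
  · rw [Polynomial.finsetSum_coeff, Finset.sum_eq_single 0]
    · simp
    · intro b _ hb; rw [Polynomial.coeff_C_mul_X_pow, if_neg (Ne.symm hb)]
    · simp
  · intro t h1 h2
    rw [Polynomial.finsetSum_coeff, Finset.sum_eq_single t]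
    · rw [Polynomial.coeff_C_mul_X_pow, if_pos rfl, if_neg (by omega)]
    · intro b _ hb; rw [Polynomial.coeff_C_mul_X_pow, if_neg (Ne.symm hb)]
    · intro h; exact absurd (Finset.mem_range.2 (by omega)) h

end mats

section final
variable {K : Type*} [Field K]

theorem hyper [IsAlgClosed K] (h2 : (2 : K) ≠ 0) {ι : Type*} [Fintype ι] [DecidableEq ι] {d : ℕ}
    (Y : OLetter d → Matrix ι ι K) :
    ∃ Z : Fin d → Matrix (ι ⊕ ι) (ι ⊕ ι) K, ∀ w : List (OLetter d),
      dd (w.map (fun l => if l.2 then (Z l.1)ᵀ else Z l.1)).prod =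
        dd (w.map Y).prod * dd ((wordT oTau w).map Y).prod := by
  obtain ⟨i, hi⟩ := IsAlgClosed.exists_pow_nat_eq (-1 : K) (n := 2) (by norm_num)
  let S : Matrix (ι ⊕ ι) (ι ⊕ ι) K :=
    Matrix.fromBlocks 1 ((2⁻¹ : K) • 1) (i • 1) ((-(i * 2⁻¹)) • 1)
  let S' : Matrix (ι ⊕ ι) (ι ⊕ ι) K :=
    Matrix.fromBlocks ((2⁻¹ : K) • 1) ((-(i * 2⁻¹)) • 1) 1 (i • 1)
  have hS : S' * S = 1 := by
    simp only [S, S', Matrix.fromBlocks_multiply, ← Matrix.fromBlocks_one]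
    congr 1 <;> ext a b <;> by_cases hab : a = b <;> simp [Matrix.one_apply, hab] <;> field_simp <;>
      first | linear_combination hi | linear_combination -hi
  have hS' : S * S' = 1 := mul_eq_one_comm.1 hS
  let D : OLetter d → Matrix (ι ⊕ ι) (ι ⊕ ι) K := fun l =>
    Matrix.fromBlocks (Y l) 0 0 (Y (oTau l))ᵀ
  have hD : ∀ l, (S * D l * S')ᵀ = S * D (oTau l) * S' := by
    intro l
    have hl : oTau (oTau l) = l := by simp [oTau]
    simp only [S, S', D, Matrix.fromBlocks_multiply, Matrix.fromBlocks_transpose, hl]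
    congr 1 <;> ext a b <;> simp <;> ring
  refine ⟨fun k => S * D (k, false) * S', fun w => ?_⟩
  have hZ : (fun l : OLetter d => if l.2 then (S * D (l.1, false) * S')ᵀ
      else S * D (l.1, false) * S') = fun l => S * D l * S' := by
    funext l
    rcases l with ⟨k, b⟩
    cases b
    · simp
    · simp [hD, oTau]
  have hprod : ∀ w : List (OLetter d), (w.map (fun l => S * D l * S')).prod =
      S * (w.map D).prod * S' := by
    intro w
    induction w with
    | nil => simp [hS']
    | cons l w ih =>
      rw [List.map_cons, List.prod_cons, ih, List.map_cons, List.prod_cons]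
      calc S * D l * S' * (S * (w.map D).prod * S')
          = S * D l * (S' * S) * (w.map D).prod * S' := by simp only [mul_assoc]
        _ = _ := by rw [hS]; simp only [mul_assoc, mul_one]
  beta_reduce
  rw [hZ, hprod, dd_conj _ _ _ hS, prod_blocks, dd_blocks]
  congr 1
  rw [← dd_transpose ((wordT oTau w).map Y).prod, Matrix.transpose_list_prod]
  simp [wordT, Function.comp_def]

theorem psi_eval {F : Type*} [Field F] [Algebra F K] {ι : Type*} [Fintype ι] [DecidableEq ι]
    {d : ℕ} (Z : Fin d → Matrix ι ι K) (f : Nsigma F d)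
    (hf : PsiO F (Fintype.card ι) d f = 0) :
    MvPolynomial.aeval (fun v : ℕ+ × WCls d =>
      (dd ((Quot.out v.2).1.map (fun l => if l.2 then (Z l.1)ᵀ else Z l.1)).prod).coeff v.1) f
      = 0 := by
  let e := Fintype.equivFin ι
  let φ : Rmat F (Fintype.card ι) d →ₐ[F] K :=
    MvPolynomial.aeval (fun p => Matrix.reindex e e (Z p.2.2) p.1 p.2.1)
  have key : φ.comp (PsiO F (Fintype.card ι) d) = MvPolynomial.aeval (fun v : ℕ+ × WCls d =>
      (dd ((Quot.out v.2).1.map (fun l => if l.2 then (Z l.1)ᵀ else Z l.1)).prod).coeff v.1) := by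
    apply MvPolynomial.algHom_ext
    intro v
    rw [AlgHom.comp_apply, PsiO, MvPolynomial.aeval_X, MvPolynomial.aeval_X]
    rw [← dd_reindex e, ← msigma_eq, Fintype.card_fin, apply_ite φ, map_zero]
    congr 1
    have h1 : φ (msigma v.1 (oWordMat F (Fintype.card ι) d (Quot.out v.2).1)) = _ :=
      msigma_map φ.toRingHom _ _
    rw [h1]
    congr 1
    have h2 : ∀ w : List (OLetter d), (φ.toRingHom.mapMatrix (oWordMat F (Fintype.card ι) d w)) =
        Matrix.reindexAlgEquiv K K e (w.map (fun l => if l.2 then (Z l.1)ᵀ else Z l.1)).prod := by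
      intro w
      rw [oWordMat, map_list_prod, map_list_prod, List.map_map, List.map_map]
      congr 1
      apply List.map_congr_left
      intro l _
      ext i j
      rcases l with ⟨k, b⟩
      cases b <;> simp [oLetterMat, genX, φ]
    exact h2 _
  rw [← key, AlgHom.comp_apply, hf, map_zero]

open Classical in
theorem exists_Rz [IsAlgClosed K] (h2 : (2 : K) ≠ 0) {d : ℕ} (c : ℕ+ × WCls d → K)
    (s : Finset (WCls d)) (T : ℕ) :
    ∃ P : List (OLetter d) → K[X], Rz K P ∧ ∀ q ∈ s, ∀ t : ℕ+, (t : ℕ) ≤ T →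
      (P (Quot.out q).1 * P (wordT oTau (Quot.out q).1)).coeff t = c (t, q) := by
  have hτ : ∀ l : OLetter d, oTau (oTau l) = l := fun l => by simp [oTau]
  have hE : ∀ q : WCls d, ∃ E : K[X], E.coeff 0 = 1 ∧ ∀ t : ℕ+, (t : ℕ) ≤ T →
      (E * (if List.IsRotated (wordT oTau (Quot.out q).1) (Quot.out q).1 then E else 1)).coeff t
        = c (t, q) := by
    intro q
    let c' : ℕ → K := fun t => if h : 0 < t then c (⟨t, h⟩, q) else 0
    split_ifs with h
    · obtain ⟨E, h0, hE⟩ := sqrtE h2 c' T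
      refine ⟨E, h0, fun t ht => ?_⟩
      rw [hE t t.2 ht]
      simp only [c', PNat.pos, dif_pos]
      rfl
    · obtain ⟨E, h0, hE⟩ := plainE c' T
      refine ⟨E, h0, fun t ht => ?_⟩
      rw [mul_one, hE t t.2 ht]
      simp only [c', PNat.pos, dif_pos]
      rfl
  choose E hE0 hE1 using hE
  refine ⟨fun b => ∏ q ∈ s, if List.IsRotated b (Quot.out q).1 then E q else 1,
    Rz.prod s (fun q b => if List.IsRotated b (Quot.out q).1 then E q else 1)
      (fun q _ => (Rz.cycleE _ (Quot.out q).2 _ (E q) rfl (hE0 q)).congr (fun b _ => by congr)), ?_⟩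
  intro q hq t ht
  rw [← hE1 q t ht]
  beta_reduce
  rw [Finset.prod_eq_single q, Finset.prod_eq_single q, if_pos (List.IsRotated.refl _)]
  · intro q' _ hne
    rw [if_neg]
    intro hr
    apply hne
    rw [← Quot.out_eq q, ← Quot.out_eq q']
    exact Quot.sound (Or.inr hr.symm)
  · intro h; exact absurd hq h
  · intro q' _ hne
    rw [if_neg]
    intro hr
    apply hne
    rw [← Quot.out_eq q, ← Quot.out_eq q']
    exact Quot.sound (Or.inl hr.symm)
  · intro h; exact absurd hq h

end final

end FR

/-- **Theorem 1.1 (orthogonal case).** Over an infinite field of characteristic `≠ 2`,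
the ideal of free relations for matrix `O(n)`-invariants is zero. -/
theorem free_relations_orthogonal (F : Type*) [Field F] [Infinite F]
    (hchar : ringChar F ≠ 2) (d : ℕ) (hd : 1 ≤ d) (f : Nsigma F d)
    (hf : ∀ n : ℕ, 1 ≤ n → PsiO F n d f = 0) : f = 0 := by
  classical
  have h2F : (2 : F) ≠ 0 := Ring.two_ne_zero hchar
  have h2 : (2 : AlgebraicClosure F) ≠ 0 := by
    have := (map_ne_zero (algebraMap F (AlgebraicClosure F))).2 h2F
    rwa [map_ofNat] at this
  apply MvPolynomial.map_injective (algebraMap F (AlgebraicClosure F))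
    (algebraMap F (AlgebraicClosure F)).injective
  rw [map_zero]
  have : Infinite (AlgebraicClosure F) := IsAlgClosed.instInfinite
  apply MvPolynomial.funext
  intro c
  rw [map_zero, MvPolynomial.eval_map]
  obtain ⟨P, ⟨ι, _, _, _, Y, hY⟩, hP⟩ := FR.exists_Rz h2 c (f.vars.image Prod.snd)
    (f.vars.sup (fun v => (v.1 : ℕ)))
  obtain ⟨Z, hZ⟩ := FR.hyper h2 Y
  have h0 := FR.psi_eval Z f (hf _ Fintype.card_pos)
  rw [← h0]
  refine MvPolynomial.eval₂Hom_congr' rfl ?_ rfl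
  intro v hv _
  rw [hZ, hY _ (Quot.out v.2).2, hY _ (FR.wordT_prim _ (fun l => by simp [oTau]) _ (Quot.out v.2).2)]
  exact (hP v.2 (Finset.mem_image_of_mem _ hv) v.1
    (Finset.le_sup (f := fun v : ℕ+ × WCls d => (v.1 : ℕ)) hv)).symm
end

section
/- (Theorem 1.1, symplectic case.) The ideal K_∞ of free relations for matrix Sp(n)-invariants is zero: if f ∈ N_σ satisfies Ψ_{2m}(f) = 0 for every m ≥ 1, then f = 0. -/
/-! Statement 1: (Theorem 1.1, symplectic case.) The ideal of free relations for
matrix `Sp(n)`-invariants is zero. -/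

open scoped BigOperators
open Matrix

/-- The matrix `J = [[0, E], [-E, 0]]` of the skew-symmetric bilinear form. -/
noncomputable def sympJ (R : Type*) [CommRing R] (m : ℕ) :
    Matrix (Fin m ⊕ Fin m) (Fin m ⊕ Fin m) R :=
  Matrix.fromBlocks 0 1 (-1) 0

/-- The symplectic transpose `A* = -J Aᵀ J` of a `2m × 2m` matrix. -/
noncomputable def sympT {R : Type*} [CommRing R] {m : ℕ}
    (A : Matrix (Fin m ⊕ Fin m) (Fin m ⊕ Fin m) R) :
    Matrix (Fin m ⊕ Fin m) (Fin m ⊕ Fin m) R :=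
  -(sympJ R m) * Aᵀ * sympJ R m

/-- The coordinate ring `R_{2m} = F[x_{ij}(k)]`, rows and columns indexed by
`Fin m ⊕ Fin m` (a `2m`-element set). -/
abbrev RmatSp (F : Type*) [CommSemiring F] (m d : ℕ) :=
  MvPolynomial ((Fin m ⊕ Fin m) × (Fin m ⊕ Fin m) × Fin d) F

/-- The generic `2m × 2m` matrix `X_k`. -/
noncomputable def genXSp (F : Type*) [CommSemiring F] (m d : ℕ) (k : Fin d) :
    Matrix (Fin m ⊕ Fin m) (Fin m ⊕ Fin m) (RmatSp F m d) :=
  Matrix.of fun i j => MvPolynomial.X (i, j, k)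

/-- The matrix of a letter: `X_k` for `x_k` and `X_k*` for `x_k^T` (symplectic case). -/
noncomputable def spLetterMat (F : Type*) [Field F] (m d : ℕ) (l : OLetter d) :
    Matrix (Fin m ⊕ Fin m) (Fin m ⊕ Fin m) (RmatSp F m d) :=
  if l.2 then sympT (genXSp F m d l.1) else genXSp F m d l.1

/-- The matrix `X_a` of a word `a = a_1 ⋯ a_r`. -/
noncomputable def spWordMat (F : Type*) [Field F] (m d : ℕ) (w : List (OLetter d)) :
    Matrix (Fin m ⊕ Fin m) (Fin m ⊕ Fin m) (RmatSp F m d) :=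
  (w.map (spLetterMat F m d)).prod

/-- The evaluation homomorphism `Ψ_{2m} : N_σ → R_{2m}`, sending `σ_t(ā)` to `σ_t(X_a)`
if `t ≤ 2m` and to `0` otherwise (it does not depend on the representative of `ā`). -/
noncomputable def PsiSp (F : Type*) [Field F] (m d : ℕ) : Nsigma F d →ₐ[F] RmatSp F m d :=
  MvPolynomial.aeval fun v : ℕ+ × WCls d =>
    if (v.1 : ℕ) ≤ 2 * m then msigma v.1 (spWordMat F m d (Quot.out v.2).1) else 0

namespace FreeRel
open Polynomial

noncomputable def D {R : Type*} [CommRing R] {ι : Type*} [Fintype ι] [DecidableEq ι]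
    (A : Matrix ι ι R) : R[X] :=
  (1 + (X : R[X]) • A.map C).det

lemma D_eq_rev {R : Type*} [CommRing R] {ι : Type*} [Fintype ι] [DecidableEq ι]
    (A : Matrix ι ι R) : D A = (-A).charpolyRev := by
  unfold D Matrix.charpolyRev
  congr 1
  ext1 i j
  simp [Matrix.map_apply]

lemma msigma_eq {R : Type*} [CommRing R] [Nontrivial R] {ι : Type*} [Fintype ι] [DecidableEq ι]
    (t : ℕ) (A : Matrix ι ι R) :
    (if t ≤ Fintype.card ι then msigma t A else 0) = (D A).coeff t := by
  have h1 : (A.map Polynomial.C + (Polynomial.X : Polynomial R) • 1).det = (-A).charpoly := by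
    unfold Matrix.charpoly
    congr 1
    ext1 i j
    by_cases h : i = j
    · subst h; simp [Matrix.charmatrix, Matrix.map_apply, add_comm]
    · simp [Matrix.charmatrix, Matrix.map_apply, h]
  rw [D_eq_rev, ← Matrix.reverse_charpoly, Polynomial.coeff_reverse, Matrix.charpoly_natDegree_eq_dim]
  split_ifs with h
  · rw [Polynomial.revAt_le h, msigma, h1]
  · rw [Polynomial.revAt_eq_self_of_lt (by omega)]
    symm
    apply Polynomial.coeff_eq_zero_of_natDegree_lt
    rw [Matrix.charpoly_natDegree_eq_dim]; omega

lemma D_map {R S : Type*} [CommRing R] [CommRing S] {ι : Type*} [Fintype ι] [DecidableEq ι]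
    (φ : R →+* S) (A : Matrix ι ι R) : (D A).map φ = D (A.map φ) := by
  unfold D
  rw [← Polynomial.coe_mapRingHom, RingHom.map_det]
  congr 1
  ext1 i j
  by_cases h : i = j
  · subst h; simp [Matrix.map_apply]
  · simp [Matrix.map_apply, h]

lemma D_mul_comm {R : Type*} [CommRing R] {ι : Type*} [Fintype ι] [DecidableEq ι]
    (A B : Matrix ι ι R) : D (A * B) = D (B * A) := by
  unfold D
  rw [Matrix.map_mul, Matrix.map_mul, ← Matrix.smul_mul, Matrix.det_one_add_mul_comm,
    Matrix.mul_smul]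

lemma D_transpose {R : Type*} [CommRing R] {ι : Type*} [Fintype ι] [DecidableEq ι]
    (A : Matrix ι ι R) : D Aᵀ = D A := by
  unfold D
  rw [← Matrix.det_transpose]
  congr 1
  ext1 i j
  simp [Matrix.one_apply, eq_comm]

lemma D_blocks {R : Type*} [CommRing R] {ι κ : Type*} [Fintype ι] [DecidableEq ι]
    [Fintype κ] [DecidableEq κ]
    (A : Matrix ι ι R) (B : Matrix κ κ R) : D (Matrix.fromBlocks A 0 0 B) = D A * D B := by
  unfold D
  rw [← Matrix.det_fromBlocks_zero₂₁ _ 0]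
  congr 1
  rw [← Matrix.fromBlocks_one, Matrix.fromBlocks_map, Matrix.fromBlocks_smul, Matrix.fromBlocks_add]
  simp

lemma D_reindex {R : Type*} [CommRing R] {ι κ : Type*} [Fintype ι] [DecidableEq ι]
    [Fintype κ] [DecidableEq κ] (e : ι ≃ κ)
    (A : Matrix ι ι R) : D (Matrix.reindexAlgEquiv R R e A) = D A := by
  unfold D
  rw [← Matrix.det_reindex_self e (1 + (X : R[X]) • A.map C)]
  congr 1
  ext1 i j
  simp [Matrix.one_apply]

lemma D_nilp {R : Type*} [Field R] {ι : Type*} [Fintype ι] [DecidableEq ι]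
    (A : Matrix ι ι R) (h : IsNilpotent A) : D A = 1 := by
  rw [D_eq_rev]
  have h2 := Matrix.isUnit_charpolyRev_of_isNilpotent h.neg
  obtain ⟨r, hr, h3⟩ := Polynomial.isUnit_iff.1 h2
  have h4 : (-A).charpolyRev.coeff 0 = 1 := by
    rw [Polynomial.coeff_zero_eq_eval_zero]; exact Matrix.eval_charpolyRev
  rw [← h3] at h4 ⊢
  simp at h4
  simp [h4]

lemma D_diag {R : Type*} [CommRing R] {ι : Type*} [Fintype ι] [DecidableEq ι] (p : ι) (z : R) :
    D (Matrix.diagonal (fun i => if i = p then z else 0)) = 1 + C z * X := by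
  unfold D
  have : (1 + (X : R[X]) • (Matrix.diagonal (fun i => if i = p then z else 0)).map C)
    = Matrix.diagonal (fun i => if i = p then 1 + C z * X else 1) := by
    ext1 i j
    by_cases h : i = j
    · subst h
      by_cases h' : i = p
      · subst h'; simp
      · simp [h']
    · simp [h]
  rw [this, Matrix.det_diagonal, Finset.prod_ite_eq' ]
  simp

def wm {R : Type*} [CommRing R] {ι : Type*} [Fintype ι] [DecidableEq ι] {L : Type*}
    (Y : L → Matrix ι ι R) (b : List L) : Matrix ι ι R := (b.map Y).prod

lemma D_rot {R : Type*} [CommRing R] {ι : Type*} [Fintype ι] [DecidableEq ι] {L : Type*}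
    (Y : L → Matrix ι ι R) {a b : List L} (h : a ~r b) : D (wm Y a) = D (wm Y b) := by
  obtain ⟨n, rfl⟩ := h
  rw [List.rotate_eq_drop_append_take_mod]
  conv_lhs => rw [← List.take_append_drop (n % a.length) a]
  unfold wm
  simp only [List.map_append, List.prod_append]
  exact D_mul_comm _ _

def Ach {K : Type*} [Field K] {L : Type*} (φ : List L → K[X]) : Prop :=
  ∃ m : ℕ, 1 ≤ m ∧ ∃ Y : L → Matrix (Fin m) (Fin m) K, ∀ b, WPrimitive b → D (wm Y b) = φ b

lemma ach_of_fintype {K : Type*} [Field K] {L : Type*} {φ : List L → K[X]} {ι : Type*} [Fintype ι]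
    [DecidableEq ι] [Nonempty ι] (Y : L → Matrix ι ι K)
    (h : ∀ b, WPrimitive b → D (wm Y b) = φ b) : Ach φ := by
  let e := Fintype.equivFin ι
  refine ⟨Fintype.card ι, Fintype.card_pos, fun l => Matrix.reindexAlgEquiv K K e (Y l), ?_⟩
  intro b hb
  rw [← h b hb, ← D_reindex e]
  congr 1
  unfold wm
  rw [map_list_prod, List.map_map]
  rfl

lemma wm_blocks {R : Type*} [CommRing R] {L : Type*} {ι κ : Type*} [Fintype ι] [DecidableEq ι]
    [Fintype κ] [DecidableEq κ] (Y : L → Matrix ι ι R) (Z : L → Matrix κ κ R) (b : List L) :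
    wm (fun l => Matrix.fromBlocks (Y l) 0 0 (Z l)) b = Matrix.fromBlocks (wm Y b) 0 0 (wm Z b) := by
  induction b with
  | nil => simp [wm]
  | cons l b ih =>
    unfold wm at ih ⊢
    simp [ih, Matrix.fromBlocks_multiply]

lemma Ach.mul {K : Type*} [Field K] {L : Type*} {φ ψ : List L → K[X]} (h1 : Ach φ) (h2 : Ach ψ) :
    Ach (fun b => φ b * ψ b) := by
  obtain ⟨m, hm, Y, hY⟩ := h1
  obtain ⟨n, hn, Z, hZ⟩ := h2
  have : Nonempty (Fin m ⊕ Fin n) := ⟨Sum.inl ⟨0, hm⟩⟩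
  apply ach_of_fintype (fun l => Matrix.fromBlocks (Y l) 0 0 (Z l))
  intro b hb
  rw [wm_blocks, D_blocks, hY b hb, hZ b hb]

lemma Ach.one {K : Type*} [Field K] {L : Type*} : Ach (fun _ : List L => (1 : K[X])) := by
  refine ⟨1, le_rfl, fun _ => 0, ?_⟩
  intro b hb
  apply D_nilp
  obtain ⟨h, -⟩ := hb
  cases b with
  | nil => exact absurd rfl h
  | cons l b => simp [wm]

lemma Ach.prod {K : Type*} [Field K] {L : Type*} {I : Type*} (s : Finset I) (φ : I → List L → K[X])
    (h : ∀ i ∈ s, Ach (φ i)) : Ach (fun b => ∏ i ∈ s, φ i b) := by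
  classical
  induction s using Finset.induction_on with
  | empty => simpa using Ach.one
  | insert i s hi ih =>
    simp only [Finset.prod_insert hi]
    exact (h i (by simp)).mul (ih fun j hj => h j (by simp [hj]))

lemma exists_sqrt {K : Type*} [Field K] (h2 : (2 : K) ≠ 0) (g : ℕ → K) (hg : g 0 = 1) (T : ℕ) :
    ∃ q : K[X], q.coeff 0 = 1 ∧ ∀ t ≤ T, (q * q).coeff t = g t := by
  induction T with
  | zero =>
    refine ⟨1, by simp, ?_⟩
    intro t ht
    obtain rfl : t = 0 := by omega
    simp [hg]
  | succ T ih =>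
    obtain ⟨q, hq, h⟩ := ih
    let c : K := (g (T+1) - (q*q).coeff (T+1)) / 2
    refine ⟨q + C c * X ^ (T+1), by simp [hq], ?_⟩
    intro t ht
    have e : (q + C c * X ^ (T+1)) * (q + C c * X ^ (T+1)) =
      q * q + (C (2 * c) * q + C (c ^ 2) * X ^ (T+1)) * X ^ (T+1) := by
      simp only [map_mul, map_pow, map_ofNat]; ring
    rw [e, Polynomial.coeff_add, Polynomial.coeff_mul_X_pow']
    split_ifs with h'
    · obtain rfl : t = T + 1 := by omega
      simp [hq, c]
      field_simp
      ring
    · rw [h t (by omega), add_zero]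

lemma exists_lin {K : Type*} [Field K] (g : ℕ → K) (hg : g 0 = 1) (T : ℕ) :
    ∃ q : K[X], q.coeff 0 = 1 ∧ ∀ t ≤ T, q.coeff t = g t := by
  refine ⟨PowerSeries.trunc (T+1) (PowerSeries.mk g), ?_, ?_⟩
  · simp [PowerSeries.coeff_trunc, hg]
  · intro t ht
    simp [PowerSeries.coeff_trunc, Nat.lt_succ_of_le ht]

lemma split_ind {K : Type*} [Field K] [IsAlgClosed K] (P : K[X] → Prop) (h1 : P 1)
    (hl : ∀ z, P (1 + C z * X)) (hm : ∀ p q, P p → P q → P (p * q)) :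
    ∀ (n : ℕ) (q : K[X]), q.natDegree = n → q.coeff 0 = 1 → P q := by
  intro n
  induction n with
  | zero =>
    intro q hq h0
    rw [Polynomial.eq_C_of_natDegree_eq_zero hq, h0]
    simpa using h1
  | succ n ih =>
    intro q hq h0
    obtain ⟨w, hw⟩ := IsAlgClosed.exists_root q (by
      intro h
      have := Polynomial.natDegree_eq_zero_iff_degree_le_zero.2 h.le
      omega)
    have hw0 : w ≠ 0 := by
      rintro rfl
      rw [Polynomial.IsRoot, ← Polynomial.coeff_zero_eq_eval_zero, h0] at hw
      exact one_ne_zero hw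
    obtain ⟨r, hr⟩ := Polynomial.dvd_iff_isRoot.2 hw
    have e : q = (1 + C (-w⁻¹) * X) * (C (-w) * r) := by
      rw [hr]
      have : (C w : K[X]) * C w⁻¹ = 1 := by rw [← C_mul, mul_inv_cancel₀ hw0, C_1]
      simp only [map_neg]
      linear_combination (- X * r) * this
    have hr0 : r ≠ 0 := by
      rintro rfl
      simp [hr] at h0
    rw [e]
    apply hm _ _ (hl _)
    apply ih
    · rw [Polynomial.natDegree_C_mul (neg_ne_zero.2 hw0)]
      rw [hr, Polynomial.natDegree_mul (Polynomial.X_sub_C_ne_zero w) hr0,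
        Polynomial.natDegree_X_sub_C] at hq
      omega
    · rw [e, Polynomial.mul_coeff_zero] at h0
      simpa using h0

section cyc
set_option linter.unusedSectionVars false
variable {L : Type*} {r : ℕ} [NeZero r]

def rd (c : ZMod r → L) (p : ZMod r) (n : ℕ) : List L := (List.range n).map (fun i : ℕ => c (p + i))

lemma rd_length (c : ZMod r → L) (p n) : (rd c p n).length = n := by simp [rd]

lemma rd_add (c : ZMod r → L) (p : ZMod r) (m n : ℕ) : rd c p (m + n) = rd c p m ++ rd c (p + m) n := by
  simp [rd, List.range_add, Function.comp_def, add_assoc]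

lemma rd_succ (c : ZMod r → L) (p : ZMod r) (n : ℕ) : rd c p (n + 1) = c p :: rd c (p + 1) n := by
  rw [add_comm, rd_add]; simp [rd]

lemma wpow_succ (e : List L) (k : ℕ) : wpow e (k + 1) = e ++ wpow e k := by
  simp [wpow, List.replicate_succ]

lemma wpow_succ' (e : List L) (k : ℕ) : wpow e (k + 1) = wpow e k ++ e := by
  simp [wpow, List.replicate_succ']

lemma wpow_length (e : List L) (k : ℕ) : (wpow e k).length = k * e.length := by
  simp [wpow]

lemma rd_pow (c : ZMod r → L) (p : ZMod r) (g : ℕ) (h : ∀ x, c (x + g) = c x) (k : ℕ) :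
    rd c p (k * g) = wpow (rd c p g) k := by
  have h2 : ∀ q, rd c (q + g) g = rd c q g := by
    intro q
    unfold rd
    apply List.map_congr_left
    intro i _
    rw [← h (q + i)]; congr 1; ring
  have h3 : ∀ k : ℕ, rd c (p + (k * g : ℕ)) g = rd c p g := by
    intro k
    induction k with
    | zero => simp
    | succ k ih => 
      have e : p + (((k + 1) * g : ℕ) : ZMod r) = (p + ((k * g : ℕ) : ZMod r)) + g := by
        push_cast; ring
      rw [e, h2, ih]
  induction k with
  | zero => simp [rd, wpow]
  | succ k ih => rw [add_mul, one_mul, rd_add, ih, h3, wpow_succ']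

lemma per_dvd (c : ZMod r → L) (hp : WPrimitive (rd c 0 r)) (n : ℕ) (h : ∀ x, c (x + n) = c x) :
    r ∣ n := by
  have hg : ∀ x, c (x + (Nat.gcd n r : ℕ)) = c x := by
    have h1 : Function.Periodic c (n : ZMod r) := h
    have h2 := h1.zsmul (Nat.gcdA n r)
    have h3 : ((Nat.gcd n r : ℕ) : ZMod r) = (Nat.gcdA n r) • (n : ZMod r) := by
      have := congrArg (Int.cast : ℤ → ZMod r) (Nat.gcd_eq_gcd_ab n r)
      push_cast at this
      rw [this]; simp [mul_comm]
    intro x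
    rw [h3]; exact h2 x
  obtain ⟨k, hk⟩ := Nat.gcd_dvd_right n r
  have hr : r ≠ 0 := NeZero.ne r
  have e := rd_pow c 0 _ hg k
  rw [mul_comm k, ← hk] at e
  have hk2 : k < 2 := by
    by_contra hk2
    exact hp.2 _ k (by omega) e
  have hk1 : k = 1 := by
    rcases k with _ | _ | k
    · simp at hk; omega
    · rfl
    · omega
  rw [hk1, mul_one] at hk
  rw [hk]; exact Nat.gcd_dvd_left n r

lemma rd_inj {c : ZMod r → L} {p q : ZMod r} {n : ℕ} (h : rd c p n = rd c q n) (hn : r ≤ n) (x : ZMod r) :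
    c (p + x) = c (q + x) := by
  have h1 := congrArg (fun l => l[x.val]?) h
  have : x.val < n := lt_of_lt_of_le (ZMod.val_lt x) hn
  simpa [rd, this] using h1

noncomputable def Ycyc {K : Type*} [Field K] (c : ZMod r → L) (y : K) (l : L) : Matrix (ZMod r) (ZMod r) K :=
  open Classical in Matrix.of fun p p' => if c p = l ∧ p' = p + 1 then y else 0

open Classical in
lemma wm_cyc {K : Type*} [Field K] (c : ZMod r → L) (y : K) (b : List L) (p p' : ZMod r) :
    wm (Ycyc c y) b p p' = if b = rd c p b.length ∧ p' = p + b.length then y ^ b.length else 0 := by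
  induction b generalizing p with
  | nil => simp [wm, rd, Matrix.one_apply, eq_comm]
  | cons l b ih =>
    have e : wm (Ycyc c y) (l :: b) = Ycyc c y l * wm (Ycyc c y) b := by simp [wm]
    rw [e, Matrix.mul_apply, Finset.sum_eq_single (p + 1)]
    · rw [ih, List.length_cons, rd_succ]
      simp only [Ycyc, Matrix.of_apply, List.cons.injEq, and_true, eq_comm (a := l)]
      have : p + 1 + (b.length : ZMod r) = p + ((b.length + 1 : ℕ) : ZMod r) := by push_cast; ring
      rw [this]
      by_cases h1 : c p = l
      · by_cases h2 : b = rd c (p+1) b.length ∧ p' = p + ((b.length + 1 : ℕ) : ZMod r)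
        · rw [if_pos h1, if_pos h2, if_pos ⟨⟨h1, h2.1⟩, h2.2⟩, pow_succ']
        · rw [if_neg h2, mul_zero, if_neg (fun h => h2 ⟨h.1.2, h.2⟩)]
      · rw [if_neg h1, zero_mul, if_neg (fun h => h1 h.1.1)]
    · intro q _ hq
      simp [Ycyc, hq]
    · simp

lemma wm_pow {R : Type*} [CommRing R] {ι : Type*} [Fintype ι] [DecidableEq ι]
    (Y : L → Matrix ι ι R) (b : List L) (k : ℕ) : wm Y b ^ k = wm Y (wpow b k) := by
  induction k with
  | zero => simp [wm, wpow]
  | succ k ih => rw [wpow_succ, pow_succ', ih]; simp [wm]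

lemma rd_rot (c : ZMod r → L) (p : ZMod r) : rd c p r ~r rd c 0 r := by
  have h1 : r = p.val + (r - p.val) := by have := ZMod.val_lt p; omega
  have h2 : r = (r - p.val) + p.val := by omega
  have e1 : rd c 0 r = rd c 0 p.val ++ rd c p (r - p.val) := by
    rw [congrArg (rd c 0) h1]
    simp [rd_add]
  have e2 : rd c p r = rd c p (r - p.val) ++ rd c 0 p.val := by
    rw [congrArg (rd c p) h2, rd_add]
    congr 2
    rw [Nat.cast_sub (ZMod.val_lt p).le]; simp
  rw [e1, e2]
  exact List.isRotated_append

open Classical in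
lemma D_cyc {K : Type*} [Field K] (c : ZMod r → L) (y : K) (hp : WPrimitive (rd c 0 r))
    (b : List L) (hb : WPrimitive b) :
    D (wm (Ycyc c y) b) = if b ~r rd c 0 r then 1 + C (y ^ r) * X else 1 := by
  split_ifs with h
  · rw [D_rot _ h, ← D_diag (0 : ZMod r) (y ^ r)]
    congr 1
    ext p p'
    rw [wm_cyc, rd_length]
    by_cases h0 : p = 0
    · subst h0; simp [Matrix.diagonal_apply, eq_comm]
    · have : ¬ (rd c 0 r = rd c p r) := by
        intro h
        apply h0
        have := per_dvd c hp p.val (fun x => by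
          have := rd_inj h le_rfl x
          rw [zero_add] at this
          rw [this]; simp [add_comm])
        have h3 := Nat.eq_zero_of_dvd_of_lt this (ZMod.val_lt p)
        exact (ZMod.val_eq_zero p).1 h3
      simp [this, Matrix.diagonal_apply, h0]
  · apply D_nilp
    by_contra hn
    apply h
    have h1 : wm (Ycyc c y) (wpow b (r + 1)) ≠ 0 := by
      intro h1
      exact hn ⟨r + 1, by rw [wm_pow, h1]⟩
    obtain ⟨p, h2⟩ : ∃ p, wpow b (r + 1) = rd c p (wpow b (r + 1)).length := by
      by_contra hc
      push Not at hc
      apply h1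
      ext p p'
      rw [wm_cyc, if_neg (fun h => hc p h.1)]
      rfl
    have hs : 0 < b.length := List.length_pos_iff.2 hb.1
    have hr : r ≠ 0 := NeZero.ne r
    rw [wpow_length] at h2
    have h3 : b ++ wpow b r = rd c p b.length ++ rd c (p + b.length) (r * b.length) := by
      rw [← wpow_succ, h2, ← rd_add]; congr 1; ring
    have h4 : wpow b r ++ b = rd c p (r * b.length) ++ rd c (p + (r * b.length : ℕ)) b.length := by
      rw [← wpow_succ', h2, ← rd_add]; congr 1; ring
    obtain ⟨h5, h6⟩ := List.append_inj h3 (by rw [rd_length])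
    obtain ⟨h7, -⟩ := List.append_inj h4 (by rw [rd_length, wpow_length])
    have h8 := rd_inj (h7.symm.trans h6) (Nat.le_mul_of_pos_right r hs)
    have h9 : r ∣ b.length := per_dvd c hp _ (fun x => by
      have := h8 (x - p)
      rw [add_sub_cancel] at this
      rw [this]; congr 1; ring)
    obtain ⟨k, hk⟩ := h9
    have h10 := rd_pow c p r (by simp) k
    rw [mul_comm, ← hk, ← h5] at h10
    have hk2 : k < 2 := by
      by_contra hk2
      exact hb.2 _ k (by omega) h10
    have hk1 : k = 1 := by
      rcases k with _ | _ | k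
      · simp at hk; exact absurd hk hb.1
      · rfl
      · omega
    rw [hk1, mul_one] at hk
    rw [h5, hk]
    exact rd_rot c p

end cyc

open Classical in
lemma ach_lin {K : Type*} [Field K] [IsAlgClosed K] {L : Type*} (a : List L) (ha : WPrimitive a) (z : K) :
    Ach (fun b => if b ~r a then 1 + C z * X else 1) := by
  have hs : 0 < a.length := List.length_pos_iff.2 ha.1
  have : NeZero a.length := ⟨hs.ne'⟩
  let c : ZMod a.length → L := fun x => a[x.val]'(ZMod.val_lt x)
  have hc : rd c 0 a.length = a := by
    apply List.ext_getElem
    · rw [rd_length]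
    · intro i h1 h2
      simp [rd, c, ZMod.val_natCast, Nat.mod_eq_of_lt h2]
  obtain ⟨y, hy⟩ := IsAlgClosed.exists_pow_nat_eq z hs
  apply ach_of_fintype (Ycyc c y)
  intro b hb
  rw [D_cyc c y (by rw [hc]; exact ha) b hb, hc, hy]

open Classical in
lemma ach_poly {K : Type*} [Field K] [IsAlgClosed K] {L : Type*} (a : List L) (ha : WPrimitive a)
    (q : K[X]) (hq : q.coeff 0 = 1) :
    Ach (fun b => if b ~r a then q else 1) := by
  refine split_ind (fun q => Ach (fun b => if b ~r a then q else 1)) ?_ ?_ ?_ _ q rfl hq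
  · simpa using Ach.one
  · exact ach_lin a ha
  · intro p q h1 h2
    have := h1.mul h2
    convert this using 2 with b
    split_ifs <;> simp

lemma wordT_wordT {d : ℕ} (w : List (OLetter d)) : wordT oTau (wordT oTau w) = w := by
  simp [wordT, oTau, Function.comp_def]

lemma wordT_wpow {d : ℕ} (e : List (OLetter d)) (m : ℕ) :
    wordT oTau (wpow e m) = wpow (wordT oTau e) m := by
  induction m with
  | zero => simp [wordT, wpow]
  | succ m ih =>
    rw [wpow_succ, wpow_succ', ← ih]
    simp [wordT]

lemma wordT_prim {d : ℕ} {w : List (OLetter d)} (h : WPrimitive w) : WPrimitive (wordT oTau w) := by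
  refine ⟨by simpa [wordT] using h.1, ?_⟩
  intro e m hm he
  apply h.2 (wordT oTau e) m hm
  rw [← wordT_wpow, ← he, wordT_wordT]

lemma wm_tr {R : Type*} [CommRing R] {ι : Type*} [Fintype ι] [DecidableEq ι] {d : ℕ}
    (Y : OLetter d → Matrix ι ι R) (w : List (OLetter d)) :
    wm (fun l => (Y (oTau l))ᵀ) w = (wm Y (wordT oTau w))ᵀ := by
  unfold wm wordT
  rw [Matrix.transpose_list_prod]
  simp [Function.comp_def, List.map_reverse]

noncomputable def evPt {F K : Type*} [Field F] [Field K] [Algebra F K] {m d : ℕ}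
    (Y : OLetter d → Matrix (Fin m) (Fin m) K) : RmatSp F m d →ₐ[F] K :=
  MvPolynomial.aeval fun v =>
    Matrix.fromBlocks (Y (v.2.2, false)) 0 0 (Y (v.2.2, true))ᵀ v.1 v.2.1

lemma evPt_gen {F K : Type*} [Field F] [Field K] [Algebra F K] {m d : ℕ}
    (Y : OLetter d → Matrix (Fin m) (Fin m) K) (k : Fin d) :
    (genXSp F m d k).map (evPt Y : RmatSp F m d →ₐ[F] K)
      = Matrix.fromBlocks (Y (k, false)) 0 0 (Y (k, true))ᵀ := by
  ext1 i j
  simp [genXSp, evPt]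

lemma evPt_letter {F K : Type*} [Field F] [Field K] [Algebra F K] {m d : ℕ}
    (Y : OLetter d → Matrix (Fin m) (Fin m) K) (l : OLetter d) :
    (spLetterMat F m d l).map (evPt Y : RmatSp F m d →ₐ[F] K)
      = Matrix.fromBlocks (Y l) 0 0 (Y (oTau l))ᵀ := by
  obtain ⟨k, b⟩ := l
  cases b with
  | false => simpa [spLetterMat, oTau] using evPt_gen Y k
  | true =>
    have hJ : (sympJ (RmatSp F m d) m).map (evPt Y : RmatSp F m d →ₐ[F] K) = sympJ K m := by
      unfold sympJ
      rw [Matrix.fromBlocks_map]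
      congr 1
      · ext1 i j
        by_cases h : i = j
        · subst h; simp
        · simp [h]
      · ext1 i j
        by_cases h : i = j
        · subst h; simp
        · simp [h]
    have hJ' : (-sympJ (RmatSp F m d) m).map (evPt Y : RmatSp F m d →ₐ[F] K) = -sympJ K m := by
      rw [← hJ]; ext1 i j; simp
    simp only [spLetterMat, if_true, sympT, oTau, Matrix.map_mul, hJ, hJ', Matrix.transpose_map,
      evPt_gen]
    simp [sympJ, Matrix.fromBlocks_transpose, Matrix.fromBlocks_multiply, Matrix.fromBlocks_neg]

lemma evPt_word {F K : Type*} [Field F] [Field K] [Algebra F K] {m d : ℕ}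
    (Y : OLetter d → Matrix (Fin m) (Fin m) K) (w : List (OLetter d)) :
    (spWordMat F m d w).map (evPt Y : RmatSp F m d →ₐ[F] K)
      = Matrix.fromBlocks (wm Y w) 0 0 (wm Y (wordT oTau w))ᵀ := by
  rw [← wm_tr, ← wm_blocks]
  unfold wm spWordMat
  have := map_list_prod (evPt Y : RmatSp F m d →ₐ[F] K).mapMatrix (w.map (spLetterMat F m d))
  rw [AlgHom.mapMatrix_apply] at this
  rw [this, List.map_map]
  congr 1
  apply List.map_congr_left
  intro l _
  simp [evPt_letter]

lemma evPt_psi {F K : Type*} [Field F] [Field K] [Algebra F K] {m d : ℕ}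
    (Y : OLetter d → Matrix (Fin m) (Fin m) K) (v : ℕ+ × WCls d) :
    evPt Y (PsiSp F m d (MvPolynomial.X v)) =
      (D (wm Y (Quot.out v.2).1) * D (wm Y (wordT oTau (Quot.out v.2).1))).coeff v.1 := by
  have h := msigma_eq (v.1 : ℕ) (spWordMat F m d (Quot.out v.2).1)
  have hc : Fintype.card (Fin m ⊕ Fin m) = 2 * m := by simp; ring
  rw [hc] at h
  rw [PsiSp, MvPolynomial.aeval_X, h]
  have h2 := D_map ((evPt Y : RmatSp F m d →ₐ[F] K) : RmatSp F m d →+* K)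
    (spWordMat F m d (Quot.out v.2).1)
  have h3 := congrArg (fun p => p.coeff (v.1 : ℕ)) h2
  simp only [Polynomial.coeff_map, RingHom.coe_coe] at h3
  rw [h3, evPt_word, D_blocks, D_transpose]

lemma rep_inj {d : ℕ} {c c' : WCls d} (h : simRel oTau (Quot.out c).1 (Quot.out c').1) : c = c' := by
  rw [← Quot.out_eq c, ← Quot.out_eq c']
  exact Quot.sound h

lemma main_eval {F : Type*} [Field F] {K : Type*} [Field K] [IsAlgClosed K] [Algebra F K]
    (h2 : (2 : K) ≠ 0) (d : ℕ) (f : Nsigma F d)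
    (hf : ∀ m : ℕ, 1 ≤ m → PsiSp F m d f = 0) (s : ℕ+ × WCls d → K) :
    MvPolynomial.aeval s f = 0 := by
  classical
  let S : Finset (WCls d) := f.vars.image Prod.snd
  let T : ℕ := f.vars.sup (fun v => (v.1 : ℕ))
  have hq : ∀ c : WCls d, ∃ q : K[X], q.coeff 0 = 1 ∧ ∀ t : ℕ+, (t : ℕ) ≤ T →
      (q * (if wordT oTau (Quot.out c).1 ~r (Quot.out c).1 then q else 1)).coeff t = s (t, c) := by
    intro c
    let g : ℕ → K := fun t => if h : 0 < t then s (⟨t, h⟩, c) else 1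
    have hg : g 0 = 1 := by simp [g]
    have hgt : ∀ t : ℕ+, g t = s (t, c) := by intro t; simp only [g, t.pos, dif_pos]; rfl
    split_ifs
    · obtain ⟨q, h0, h⟩ := exists_sqrt h2 g hg T
      exact ⟨q, h0, fun t ht => by rw [h t ht, hgt]⟩
    · obtain ⟨q, h0, h⟩ := exists_lin g hg T
      exact ⟨q, h0, fun t ht => by rw [mul_one, h t ht, hgt]⟩
  choose q hq0 hq1 using hq
  obtain ⟨m, hm, Y, hY⟩ := Ach.prod S (fun c b => if b ~r (Quot.out c).1 then q c else 1)
    (fun c _ => by convert ach_poly _ (Quot.out c).2 (q c) (hq0 c))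
  beta_reduce at hY
  have key : ∀ v ∈ f.vars, evPt Y (PsiSp F m d (MvPolynomial.X v)) = s v := by
    rintro ⟨t, c⟩ hv
    have hcS : c ∈ S := Finset.mem_image.2 ⟨_, hv, rfl⟩
    have ht : (t : ℕ) ≤ T := Finset.le_sup (f := fun v : ℕ+ × WCls d => (v.1 : ℕ)) hv
    rw [evPt_psi, hY _ (Quot.out c).2, hY _ (wordT_prim (Quot.out c).2), ← hq1 c t ht]
    congr 2
    · rw [Finset.prod_eq_single_of_mem c hcS]
      · rw [if_pos (List.IsRotated.refl _)]
      · intro c' _ hne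
        rw [if_neg]
        intro h
        exact hne (rep_inj (Or.inl h)).symm
    · rw [Finset.prod_eq_single_of_mem c hcS]
      intro c' _ hne
      rw [if_neg]
      intro h
      exact hne (rep_inj (Or.inr h.symm))
  have e : MvPolynomial.aeval s f = ((evPt Y).comp (PsiSp F m d)) f := by
    apply MvPolynomial.hom_congr_vars (f₁ := ((MvPolynomial.aeval s : Nsigma F d →ₐ[F] K) : Nsigma F d →+* K))
      (f₂ := (((evPt Y).comp (PsiSp F m d) : Nsigma F d →ₐ[F] K) : Nsigma F d →+* K)) _ _ rfl
    · ext x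
      simp only [RingHom.comp_apply, RingHom.coe_coe, ← MvPolynomial.algebraMap_eq, AlgHom.commutes]
    · intro v hv _
      simp only [RingHom.coe_coe, AlgHom.comp_apply]
      rw [key v hv, MvPolynomial.aeval_X]
  rw [e, AlgHom.comp_apply, hf m hm, map_zero]

end FreeRel

/-- **Theorem 1.1 (symplectic case).** Over an infinite field of characteristic `≠ 2`,
the ideal of free relations for matrix `Sp(n)`-invariants is zero. -/
theorem free_relations_symplectic (F : Type*) [Field F] [Infinite F]
    (hchar : ringChar F ≠ 2) (d : ℕ) (hd : 1 ≤ d) (f : Nsigma F d)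
    (hf : ∀ m : ℕ, 1 ≤ m → PsiSp F m d f = 0) : f = 0 := by
  have h2F : (2 : F) ≠ 0 := Ring.two_ne_zero hchar
  have h2 : (2 : AlgebraicClosure F) ≠ 0 := by
    have h := (map_ne_zero (algebraMap F (AlgebraicClosure F))).2 h2F
    rwa [map_ofNat] at h
  apply MvPolynomial.map_injective (algebraMap F (AlgebraicClosure F))
    (algebraMap F (AlgebraicClosure F)).injective
  rw [map_zero]
  apply MvPolynomial.funext
  intro s
  rw [map_zero, MvPolynomial.eval_map]
  exact FreeRel.main_eval h2 d f hf s
end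

section
/- (Lemma 3.6.) Let q ≥ 1 and let a be a primitive word in M̂(q−1) such that deg_{x_k}(a) ≠ 0 for some 1 ≤ k ≤ d and such that some cyclic permutation of a equals a^T. Let f_1,…,f_s be pairwise distinct monomials f_i = Π_{j=1}^{r_i} σ_{t_{ij}}(ā)^{m_{ij}} in N̂_σ(q−1), where r_i > 0, t_{i1} > ⋯ > t_{i r_i} ≥ 1, and each m_{ij} > 0 is not divisible by p = char F. Then: if p ≠ 2, the elements ∂_q(f_1),…,∂_q(f_s) are linearly independent over F in N̂_σ(q); and if p = 2, then ∂_q(f_i) = 0 for all i. -/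
/-! Statement 12: (Lemma 3.6.) Derivatives of distinct monomials in the sigmas of a
primitive word `a` with `a ∼_c a^T`: linearly independent if `p ≠ 2`, zero if `p = 2`. -/

open scoped BigOperators
open Matrix

/-- Base names of letters: `Sum.inl k` is `x_k`, `Sum.inr (k, s)` is `y_{ks}`. -/
abbrev HBase (d : ℕ) := Fin d ⊕ (Fin d × ℕ+)

/-- Letters of `M̂`: a base name together with a flag marking the transpose. -/
abbrev HLetter (d : ℕ) := HBase d × Bool

/-- The involution on letters: `z ↦ z^T`, `z^T ↦ z`. -/
def hTau {d : ℕ} (l : HLetter d) : HLetter d := (l.1, !l.2)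

/-- The level of a letter: `0` for `x_k`, `x_k^T`, and `s` for `y_{ks}`, `y_{ks}^T`.
A word lies in `M̂(q)` iff all its letters have level `≤ q`. -/
def letterLevel {d : ℕ} (l : HLetter d) : ℕ :=
  match l.1 with
  | Sum.inl _ => 0
  | Sum.inr (_, s) => s

/-- Primitive words in `M̂`. -/
def PrimWordH (d : ℕ) := {w : List (HLetter d) // WPrimitive w}

/-- `∼`-equivalence classes of primitive words of `M̂`. -/
def WClsH (d : ℕ) := Quot (fun a b : PrimWordH d => simRel hTau a.1 b.1)

/-- The polynomial algebra `N̂_σ` on indeterminates `σ_t(ā)`, `t ≥ 1`,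
`ā` a `∼`-class of primitive words of `M̂`. -/
abbrev NsigmaH (F : Type*) [CommSemiring F] (d : ℕ) := MvPolynomial (ℕ+ × WClsH d) F

/-- `tr(w) = σ_1(w̄)` for a primitive word `w` (and junk value `0` otherwise; all words
to which `tr` is applied below are primitive). -/
noncomputable def trW (F : Type*) [CommSemiring F] {d : ℕ} (w : List (HLetter d)) :
    NsigmaH F d := by
  classical exact
    if h : WPrimitive w then MvPolynomial.X (1, Quot.mk _ (⟨w, h⟩ : PrimWordH d)) else 0

/-- `σ_t(ā)` as an element of `N̂_σ`, with the convention `σ_0 = 1`. -/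
noncomputable def sigVar (F : Type*) [CommSemiring F] {d : ℕ} (t : ℕ) (c : WClsH d) :
    NsigmaH F d :=
  if h : 0 < t then MvPolynomial.X ((⟨t, h⟩ : ℕ+), c) else 1

/-- The list of words occurring in `∂_q(a) = Σ_j a_1 ⋯ ∂_q(a_j) ⋯ a_r` (a summand for
each position `j` holding a letter `x_k` or `x_k^T`, which is replaced by `y_{kq}` or
`y_{kq}^T`; positions holding `y`-letters contribute `0` and are omitted). -/
def derivWords {d : ℕ} (q : ℕ+) (a : List (HLetter d)) : List (List (HLetter d)) :=
  (List.range a.length).filterMap fun j =>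
    match a[j]? with
    | some (Sum.inl k, b) => some (a.set j (Sum.inr (k, q), b))
    | _ => none

/-- The value of the symbolic derivation `∂_q` on the indeterminate `σ_t(ā)`:
`∂_q(σ_t(a)) = Σ_{i=0}^{t-1} (-1)^i tr(a^i ∂_q(a)) σ_{t-i-1}(a)`. -/
noncomputable def dVal (F : Type*) [CommRing F] {d : ℕ} (q : ℕ+)
    (v : ℕ+ × WClsH d) : NsigmaH F d :=
  ∑ i ∈ Finset.range (v.1 : ℕ),
    (-1 : NsigmaH F d) ^ i *
      ((derivWords q (Quot.out v.2).1).map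
          (fun w => trW F (wpow (Quot.out v.2).1 i ++ w))).sum *
        sigVar F ((v.1 : ℕ) - i - 1) v.2

/-- The symbolic derivation `∂_q : N̂_σ → N̂_σ` (defined on indeterminates by `dVal` and
extended by linearity and the Leibniz rule). -/
noncomputable def DS (F : Type*) [CommRing F] (d : ℕ) (q : ℕ+) :
    Derivation F (NsigmaH F d) (NsigmaH F d) :=
  MvPolynomial.mkDerivation F (dVal F q)

/-- Variables of the polynomial ring `R̂_n`: `Sum.inl (i,j,k)` is `x_{ij}(k)` and
`Sum.inr (i,j,k,s)` is `y_{ij}(k,s)`. -/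
abbrev VarHat (n d : ℕ) := (Fin n × Fin n × Fin d) ⊕ (Fin n × Fin n × Fin d × ℕ+)

/-- The polynomial ring `R̂_n = F[x_{ij}(k), y_{ij}(k,s)]`. -/
abbrev Rhat (F : Type*) [CommSemiring F] (n d : ℕ) := MvPolynomial (VarHat n d) F

/-- The derivation `∂_q(f) = Σ_k Σ_{i,j} (∂f/∂x_{ij}(k))·y_{ij}(k,q)` on `R̂_n`. -/
noncomputable def Dq (F : Type*) [Field F] (n d : ℕ) (q : ℕ+) (f : Rhat F n d) :
    Rhat F n d :=
  ∑ k : Fin d, ∑ i : Fin n, ∑ j : Fin n,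
    MvPolynomial.pderiv (Sum.inl (i, j, k)) f * MvPolynomial.X (Sum.inr (i, j, k, q))

/-- The matrix of a letter: generic matrices `X_k`, `Y_{ks}` and their transposes. -/
noncomputable def hLetterMat (F : Type*) [Field F] (n d : ℕ) (l : HLetter d) :
    Matrix (Fin n) (Fin n) (Rhat F n d) :=
  match l with
  | (Sum.inl k, false) => Matrix.of fun i j => MvPolynomial.X (Sum.inl (i, j, k))
  | (Sum.inl k, true) => (Matrix.of fun i j =>
      (MvPolynomial.X (Sum.inl (i, j, k)) : Rhat F n d))ᵀ
  | (Sum.inr (k, s), false) => Matrix.of fun i j => MvPolynomial.X (Sum.inr (i, j, k, s))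
  | (Sum.inr (k, s), true) => (Matrix.of fun i j =>
      (MvPolynomial.X (Sum.inr (i, j, k, s)) : Rhat F n d))ᵀ

/-- The matrix `X_a` of a word `a = a_1 ⋯ a_r` of `M̂`. -/
noncomputable def hWordMat (F : Type*) [Field F] (n d : ℕ) (w : List (HLetter d)) :
    Matrix (Fin n) (Fin n) (Rhat F n d) :=
  (w.map (hLetterMat F n d)).prod

/-- The evaluation homomorphism `Ψ̂_n : N̂_σ → R̂_n`, sending `σ_t(ā)` to `σ_t(X_a)` if
`t ≤ n` and to `0` otherwise (it does not depend on the representative of `ā`). -/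
noncomputable def PsiHat (F : Type*) [Field F] (n d : ℕ) :
    NsigmaH F d →ₐ[F] Rhat F n d :=
  MvPolynomial.aeval fun v : ℕ+ × WClsH d =>
    if (v.1 : ℕ) ≤ n then msigma v.1 (hWordMat F n d (Quot.out v.2).1) else 0

section Words
variable {A : Type*}

lemma wpow_zero' (e : List A) : wpow e 0 = [] := by simp [wpow]
lemma wpow_succ' (e : List A) (n : ℕ) : wpow e (n+1) = e ++ wpow e n := by
  simp [wpow, List.replicate_succ]
lemma wpow_add' (e : List A) (m n : ℕ) : wpow e (m+n) = wpow e m ++ wpow e n := by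
  induction m with
  | zero => simp [wpow_zero']
  | succ m ih => rw [Nat.add_right_comm, wpow_succ', wpow_succ', ih, List.append_assoc]
lemma wpow_one' (e : List A) : wpow e 1 = e := by simp [wpow]

lemma wpow_shift (u v : List A) (n : ℕ) :
    u ++ wpow (v ++ u) n = wpow (u ++ v) n ++ u := by
  induction n with
  | zero => simp [wpow_zero']
  | succ n ih => rw [wpow_succ', wpow_succ']; simp only [List.append_assoc]; rw [← ih]

lemma wpow_length (e : List A) (n : ℕ) : (wpow e n).length = n * e.length := by
  induction n with
  | zero => simp [wpow_zero']
  | succ n ih => rw [wpow_succ', List.length_append, ih]; ring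

lemma wpow_countP (p : A → Bool) (e : List A) (n : ℕ) :
    (wpow e n).countP p = n * e.countP p := by
  induction n with
  | zero => simp [wpow_zero']
  | succ n ih => rw [wpow_succ', List.countP_append, ih]; ring

lemma wpow_nil' (n : ℕ) : wpow ([] : List A) n = [] := by
  simp [wpow]

lemma mem_wpow {e : List A} {n : ℕ} {x : A} (h : x ∈ wpow e n) : x ∈ e := by
  simp only [wpow, List.mem_flatten, List.mem_replicate] at h
  obtain ⟨l, ⟨_, rfl⟩, h⟩ := h
  exact h

lemma comm_pow : ∀ (N : ℕ) (u v : List A), u.length + v.length ≤ N → u ++ v = v ++ u →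
    ∃ (e : List A) (i j : ℕ), u = wpow e i ∧ v = wpow e j := by
  intro N
  induction N with
  | zero =>
    intro u v h _
    have hu : u = [] := List.length_eq_zero_iff.1 (by omega)
    have hv : v = [] := List.length_eq_zero_iff.1 (by omega)
    exact ⟨[], 0, 0, by simp [hu, wpow_zero'], by simp [hv, wpow_zero']⟩
  | succ N ih =>
    have key : ∀ u v : List A, u.length ≤ v.length → u.length + v.length ≤ N + 1 →
        u ++ v = v ++ u → ∃ (e : List A) (i j : ℕ), u = wpow e i ∧ v = wpow e j := by
      intro u v hle h heq
      by_cases hu : u = []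
      · exact ⟨v, 0, 1, by simp [hu, wpow_zero'], by simp [wpow_one']⟩
      have hul : 0 < u.length := List.length_pos_iff.2 hu
      have hp : u <+: v := List.prefix_of_prefix_length_le (l₃ := u ++ v) ⟨v, rfl⟩
        ⟨u, heq.symm⟩ hle
      obtain ⟨w, rfl⟩ := hp
      have h2 : u ++ w = w ++ u := by
        have : u ++ (u ++ w) = u ++ (w ++ u) := by simpa using heq
        exact List.append_cancel_left this
      obtain ⟨e, i, j, h3, h4⟩ := ih u w (by simp at h; omega) h2
      exact ⟨e, i, i + j, h3, by rw [wpow_add', ← h3, ← h4]⟩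
    intro u v h heq
    rcases le_total u.length v.length with hl | hl
    · exact key u v hl h heq
    · obtain ⟨e, i, j, h3, h4⟩ := key v u hl (by omega) heq.symm
      exact ⟨e, j, i, h4, h3⟩

lemma prim_rotate {b : List A} (hb : WPrimitive b) {s : ℕ} (hs : 0 < s) (hl : s < b.length) :
    b.rotate s ≠ b := by
  intro h
  rw [List.rotate_eq_drop_append_take hl.le] at h
  have h2 : b.take s ++ b.drop s = b.drop s ++ b.take s := by rw [h, List.take_append_drop]
  obtain ⟨e, i, j, h3, h4⟩ := comm_pow _ _ _ le_rfl h2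
  have hb' : b = wpow e (i + j) := by rw [wpow_add', ← h3, ← h4, List.take_append_drop]
  have hi : i ≠ 0 := by
    rintro rfl
    have := congrArg List.length h3
    simp [wpow_zero'] at this
    rcases this with h | h
    · omega
    · exact hb.1 h
  have hj : j ≠ 0 := by
    rintro rfl
    have := congrArg List.length h4
    simp [wpow_zero'] at this
    omega
  exact hb.2 e (i+j) (by omega) hb'

lemma prim_rotate_inj {b : List A} (hb : WPrimitive b) {i j : ℕ} (hi : i < b.length)
    (hj : j < b.length) (h : b.rotate i = b.rotate j) : i = j := by
  have key : ∀ i j, i < j → j < b.length → b.rotate i = b.rotate j → False := by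
    intro i j hij hj h
    have : b.rotate j = (b.rotate (j - i)).rotate i := by
      rw [List.rotate_rotate]; congr 1; omega
    rw [this] at h
    exact prim_rotate hb (s := j - i) (by omega) (by omega) (List.rotate_injective i h).symm
  rcases lt_trichotomy i j with h1 | h1 | h1
  · exact (key i j h1 hj h).elim
  · exact h1
  · exact (key j i h1 hi h.symm).elim

lemma rot_split {u v : List A} (h : List.IsRotated u v) : ∃ l₁ l₂, u = l₁ ++ l₂ ∧ v = l₂ ++ l₁ := by
  obtain ⟨n, hn, rfl⟩ := List.isRotated_iff_mod.1 h
  exact ⟨u.take n, u.drop n, by simp, List.rotate_eq_drop_append_take hn⟩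

lemma rot_head {P : A → Prop} {y y' : A} {U V : List A}
    (h : List.IsRotated (y :: U) (y' :: V)) (hy' : P y') (hU : ∀ z ∈ U, ¬ P z) :
    y :: U = y' :: V := by
  obtain ⟨l₁, l₂, h1, h2⟩ := rot_split h
  cases l₁ with
  | nil => simp at h1 h2; simp [h1, h2]
  | cons z l₁ =>
    cases l₂ with
    | nil => simp at h1 h2; simp [h1, h2]
    | cons z' l₂ =>
      simp at h1 h2
      exact (hU y' (by rw [h1.2, h2.1]; simp) hy').elim

lemma prim_of_count {p : A → Bool} {w : List A} (h : w.countP p = 1) : WPrimitive w := by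
  refine ⟨by rintro rfl; simp at h, ?_⟩
  rintro e m hm rfl
  rw [wpow_countP] at h
  have := Nat.eq_one_of_mul_eq_one_right h
  omega

lemma wordT_append (τ : A → A) (u v : List A) : wordT τ (u ++ v) = wordT τ v ++ wordT τ u := by
  simp [wordT]

lemma wordT_wpow (τ : A → A) (u : List A) (n : ℕ) : wordT τ (wpow u n) = wpow (wordT τ u) n := by
  induction n with
  | zero => simp [wpow_zero', wordT]
  | succ n ih =>
    rw [wpow_succ', wordT_append, ih]
    rw [wpow_add', wpow_one']

lemma wordT_rot (τ : A → A) {u v : List A} (h : List.IsRotated u v) :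
    List.IsRotated (wordT τ u) (wordT τ v) := (h.reverse).map τ

lemma wordT_wordT {τ : A → A} (hτ : ∀ x, τ (τ x) = x) (u : List A) :
    wordT τ (wordT τ u) = u := by
  simp [wordT, Function.comp_def, hτ]

lemma simRel_equiv {τ : A → A} (hτ : ∀ x, τ (τ x) = x) : Equivalence (simRel (A := A) τ) where
  refl u := Or.inl (List.IsRotated.refl u)
  symm := by
    rintro u v (h | h)
    · exact Or.inl h.symm
    · right
      have := wordT_rot τ h
      rw [wordT_wordT hτ] at this
      exact this.symm
  trans := by
    rintro u v w (h | h) (h' | h')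
    · exact Or.inl (h.trans h')
    · exact Or.inr (h.trans h')
    · exact Or.inr (h.trans (wordT_rot τ h'))
    · left
      have := wordT_rot τ h'
      rw [wordT_wordT hτ] at this
      exact h.trans this

end Words

lemma hTau_hTau {d : ℕ} (x : HLetter d) : hTau (hTau x) = x := by simp [hTau]

lemma cls_eq_iff {d : ℕ} (u v : PrimWordH d) :
    (Quot.mk _ u : WClsH d) = Quot.mk _ v ↔ simRel hTau u.1 v.1 := by
  have he := simRel_equiv (A := HLetter d) (τ := hTau) hTau_hTau
  have he' : Equivalence (fun a b : PrimWordH d => simRel hTau a.1 b.1) :=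
    ⟨fun _ => he.refl _, fun h => he.symm h, fun h h' => he.trans h h'⟩
  constructor
  · intro h
    exact he'.eqvGen_iff.1 (Quot.eqvGen_exact h)
  · exact fun h => Quot.sound h

lemma trW_of_prim (F : Type*) [CommSemiring F] {d : ℕ} {w : List (HLetter d)}
    (h : WPrimitive w) : trW F w = MvPolynomial.X (1, Quot.mk _ (⟨w, h⟩ : PrimWordH d)) := by
  unfold trW
  exact dif_pos h

lemma trW_congr (F : Type*) [CommSemiring F] {d : ℕ} {u v : List (HLetter d)}
    (hu : WPrimitive u) (hv : WPrimitive v) (h : simRel hTau u v) : trW F u = trW F v := by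
  rw [trW_of_prim F hu, trW_of_prim F hv]
  exact congrArg (fun z : WClsH d => (MvPolynomial.X (1, z) : NsigmaH F d))
    ((cls_eq_iff ⟨u, hu⟩ ⟨v, hv⟩).2 h)

def isX {d : ℕ} (l : HLetter d) : Bool := l.1.isLeft

def ysub {d : ℕ} (q : ℕ+) (l : HLetter d) : HLetter d :=
  match l with
  | (Sum.inl k, b) => (Sum.inr (k, q), b)
  | (Sum.inr k, b) => (Sum.inr k, b)

def lq {d : ℕ} (q : ℕ+) (l : HLetter d) : Bool := decide (letterLevel l = (q : ℕ))

lemma ysub_inj {d : ℕ} {q : ℕ+} {x x' : HLetter d} (h : isX x) (h' : isX x')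
    (e : ysub q x = ysub q x') : x = x' := by
  obtain ⟨x | x, b⟩ := x <;> obtain ⟨x' | x', b'⟩ := x' <;> simp_all [isX, ysub]

lemma lq_ysub {d : ℕ} {q : ℕ+} {x : HLetter d} (h : isX x) : lq q (ysub q x) = true := by
  obtain ⟨x | x, b⟩ := x <;> simp_all [isX, ysub, lq, letterLevel]

lemma isX_tau {d : ℕ} (x : HLetter d) : isX (hTau x) = isX x := rfl
lemma lq_tau {d : ℕ} (q : ℕ+) (x : HLetter d) : lq q (hTau x) = lq q x := rfl
lemma ysub_tau {d : ℕ} {q : ℕ+} (x : HLetter d) : ysub q (hTau x) = hTau (ysub q x) := by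
  obtain ⟨x | x, b⟩ := x <;> simp [hTau, ysub]
lemma tau_ne {d : ℕ} (x : HLetter d) : hTau x ≠ x := by
  obtain ⟨x, b⟩ := x
  simp [hTau]

/-- canonical word with the marked letter in front -/
def K {d : ℕ} (q : ℕ+) (n : ℕ) (c : List (HLetter d)) : List (HLetter d) :=
  match c with
  | [] => []
  | x :: R => ysub q x :: (R ++ wpow (x :: R) n)

/-- reflected rotation -/
def sh {d : ℕ} (c : List (HLetter d)) : List (HLetter d) :=
  match c with
  | [] => []
  | x :: R => hTau x :: wordT hTau R

lemma sh_sh {d : ℕ} (c : List (HLetter d)) : sh (sh c) = c := by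
  cases c with
  | nil => rfl
  | cons x R => simp [sh, hTau_hTau, wordT_wordT hTau_hTau]

lemma sh_rot {d : ℕ} (c : List (HLetter d)) : List.IsRotated (sh c) (wordT hTau c) := by
  cases c with
  | nil => exact List.IsRotated.refl _
  | cons x R =>
    have : wordT hTau (x :: R) = wordT hTau R ++ [hTau x] := by simp [wordT]
    rw [this]
    exact List.isRotated_append (l := [hTau x]) (l' := wordT hTau R)

/-- `c` starts with an `x`-letter and has no letters of level `q` -/
def Good {d : ℕ} (q : ℕ+) (c : List (HLetter d)) : Prop :=
  (∀ x ∈ c, lq q x = false) ∧ ∃ x R, c = x :: R ∧ isX x = true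

lemma Good.sh {d : ℕ} {q : ℕ+} {c : List (HLetter d)} (h : Good q c) : Good q (sh c) := by
  obtain ⟨h1, x, R, rfl, hx⟩ := h
  refine ⟨?_, hTau x, wordT hTau R, rfl, hx⟩
  intro z hz
  rw [(sh_rot _).mem_iff] at hz
  simp only [wordT, List.mem_map, List.mem_reverse] at hz
  obtain ⟨z, hz, rfl⟩ := hz
  exact h1 z hz

lemma Good.sh_ne {d : ℕ} {q : ℕ+} {c : List (HLetter d)} (h : Good q c) : _root_.sh c ≠ c := by
  obtain ⟨h1, x, R, rfl, hx⟩ := h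
  intro h
  simp only [_root_.sh, List.cons.injEq] at h
  exact tau_ne x h.1

lemma K_count {d : ℕ} {q : ℕ+} {c : List (HLetter d)} (h : Good q c) (n : ℕ) :
    (K q n c).countP (lq q) = 1 := by
  obtain ⟨h1, x, R, rfl, hx⟩ := h
  have h0 : (x :: R).countP (lq q) = 0 := List.countP_eq_zero.2 (by simpa using h1)
  have hR : R.countP (lq q) = 0 := List.countP_eq_zero.2 (by simpa using fun z hz => h1 z (by simp [hz]))
  rw [K, List.countP_cons, List.countP_append, wpow_countP, h0, hR, lq_ysub hx]
  simp

lemma K_prim {d : ℕ} {q : ℕ+} {c : List (HLetter d)} (h : Good q c) (n : ℕ) :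
    WPrimitive (K q n c) := prim_of_count (K_count h n)

lemma K_length {d : ℕ} {q : ℕ+} (n : ℕ) (c : List (HLetter d)) :
    (K q n c).length = (n + 1) * c.length := by
  cases c with
  | nil => simp [K]
  | cons x R => simp [K, wpow_length]; ring

lemma K_sh {d : ℕ} {q : ℕ+} (n : ℕ) (c : List (HLetter d)) :
    List.IsRotated (wordT hTau (K q n c)) (K q n (sh c)) := by
  cases c with
  | nil => exact List.IsRotated.refl _
  | cons x R =>
    have e1 : ∀ (z : HLetter d) S, wordT hTau (z :: S) = wordT hTau S ++ [hTau z] := by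
      intros; simp [wordT]
    rw [K, sh, K, e1, wordT_append, wordT_wpow, e1, ysub_tau]
    have := wpow_shift (wordT hTau R) [hTau x] n
    rw [List.singleton_append] at this
    rw [← this]
    exact List.isRotated_append (l' := [hTau (ysub q x)])

lemma K_rot_inj {d : ℕ} {q : ℕ+} {c c' : List (HLetter d)} (h : Good q c) (h' : Good q c')
    (hl : c.length = c'.length) {n n' : ℕ} (hr : List.IsRotated (K q n c) (K q n' c')) :
    n = n' ∧ c = c' := by
  have hlen := hr.perm.length_eq
  rw [K_length, K_length, hl] at hlen
  obtain ⟨h1, x, R, rfl, hx⟩ := h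
  obtain ⟨h1', x', R', rfl, hx'⟩ := h'
  have hn : n = n' := by
    have := Nat.eq_of_mul_eq_mul_right (by simp) hlen
    omega
  subst hn
  refine ⟨rfl, ?_⟩
  have := rot_head (P := fun z => lq q z = true) hr (lq_ysub hx') (by
    intro z hz
    have : z ∈ x :: R := by
      rcases List.mem_append.1 hz with hz | hz
      · exact List.mem_cons_of_mem _ hz
      · exact mem_wpow hz
    simp [h1 z this])
  simp only [List.cons.injEq] at this
  rw [ysub_inj hx hx' this.1, (List.append_inj this.2 (by simpa using hl)).1]

lemma K_sim_iff {d : ℕ} {q : ℕ+} {c c' : List (HLetter d)} (h : Good q c) (h' : Good q c')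
    (hl : c.length = c'.length) {n n' : ℕ} :
    simRel hTau (K q n c) (K q n' c') ↔ n = n' ∧ (c = c' ∨ c = sh c') := by
  constructor
  · rintro (hr | hr)
    · have := K_rot_inj h h' hl hr
      exact ⟨this.1, Or.inl this.2⟩
    · have := K_rot_inj h h'.sh (by
        rw [hl, (sh_rot c').perm.length_eq]; simp [wordT]) (hr.trans (K_sh n' c'))
      exact ⟨this.1, Or.inr this.2⟩
  · rintro ⟨rfl, rfl | rfl⟩
    · exact (simRel_equiv hTau_hTau).refl _
    · exact Or.inr (K_sh n c').symm

/-- the cut-and-mark step -/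
lemma set_rot {d : ℕ} {q : ℕ+} (b : List (HLetter d)) (j : ℕ) (hj : j < b.length) (n : ℕ) :
    List.IsRotated (wpow b n ++ b.set j (ysub q b[j])) (K q n (b.rotate j)) := by
  have hb : b = b.take j ++ (b[j] :: b.drop (j+1)) := by simp
  have hr : b.rotate j = b[j] :: (b.drop (j+1) ++ b.take j) := by
    rw [List.rotate_eq_drop_append_take hj.le, List.drop_eq_getElem_cons hj]; rfl
  rw [hr, K, List.set_eq_take_append_cons_drop, if_pos hj]
  have := wpow_shift (b.take j) (b[j] :: b.drop (j+1)) n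
  rw [← hb] at this
  rw [List.append_assoc, ← List.cons_append] 
  rw [List.cons_append] at this
  rw [this, ← List.append_assoc]
  exact List.isRotated_append

lemma filterMap_sum {M B : Type*} [AddCommMonoid M] (N : ℕ) (φ : ℕ → Option B) (g : B → M) :
    (((List.range N).filterMap φ).map g).sum = ∑ j ∈ Finset.range N, (φ j).elim 0 g := by
  induction N with
  | zero => simp
  | succ N ih =>
    rw [List.range_succ, List.filterMap_append, List.map_append, List.sum_append, ih,
      Finset.sum_range_succ]
    congr 1
    cases h : φ N <;> simp [h]

lemma derivWords_sum {M : Type*} [AddCommMonoid M] {d : ℕ} (q : ℕ+) (b : List (HLetter d))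
    (g : List (HLetter d) → M) :
    ((derivWords q b).map g).sum =
      ∑ j ∈ Finset.univ.filter (fun j : Fin b.length => isX b[j] = true),
        g (b.set j (ysub q b[j])) := by
  rw [derivWords, filterMap_sum, Finset.sum_range, Finset.sum_filter]
  refine Finset.sum_congr rfl fun j _ => ?_
  have h1 : b[(j : ℕ)]? = some b[j] := by simp
  rw [h1]
  rcases h : b[j] with ⟨k | k, e⟩
  · simp [isX, ysub]
  · simp [isX]

lemma T_sum (F : Type*) [CommRing F] {d : ℕ} (q : ℕ+) (b : List (HLetter d))
    (hb : WPrimitive b) (hlev : ∀ x ∈ b, lq q x = false) (hx : ∃ x ∈ b, isX x = true)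
    (hc : List.IsRotated b (wordT hTau b)) :
    ∃ S : Finset (List (HLetter d)), S.Nonempty ∧ (∀ c ∈ S, Good q c ∧ c.length = b.length ∧
      sh c ∈ S) ∧
      ∀ n, ((derivWords q b).map (fun w => trW F (wpow b n ++ w))).sum =
        ∑ c ∈ S, trW F (K q n c) := by
  classical
  have hgood : ∀ j : Fin b.length, isX b[j] = true → Good q (b.rotate j) := by
    intro j hj
    refine ⟨fun z hz => hlev z (List.mem_rotate.1 hz), b[j], b.drop (j+1) ++ b.take j, ?_, hj⟩
    rw [List.rotate_eq_drop_append_take j.2.le, List.drop_eq_getElem_cons j.2]; rfl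
  have hmem : ∀ c, Good q c → List.IsRotated b c →
      ∃ j : Fin b.length, isX b[j] = true ∧ b.rotate j = c := by
    rintro c ⟨_, x, R, rfl, hx⟩ hr
    obtain ⟨n, rfl'⟩ := hr
    have hpos : 0 < b.length := List.length_pos_iff.2 hb.1
    refine ⟨⟨n % b.length, Nat.mod_lt _ hpos⟩, ?_, by simp [List.rotate_mod, rfl']⟩
    rw [← List.rotate_mod, List.rotate_eq_drop_append_take (Nat.mod_lt _ hpos).le,
      List.drop_eq_getElem_cons (Nat.mod_lt _ hpos)] at rfl'
    simp only [List.cons_append, List.cons.injEq] at rfl'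
    simpa [rfl'.1] using hx
  refine ⟨(Finset.univ.filter (fun j : Fin b.length => isX b[j] = true)).image
    (fun j : Fin b.length => b.rotate j), ?_, ?_, ?_⟩
  · obtain ⟨x, hxb, hx⟩ := hx
    obtain ⟨j, hj, rfl⟩ := List.getElem_of_mem hxb
    exact ⟨b.rotate j, Finset.mem_image.2 ⟨⟨j, hj⟩, by simpa using hx, rfl⟩⟩
  · intro c hcS
    obtain ⟨j, hj, rfl⟩ := Finset.mem_image.1 hcS
    have hj' := (Finset.mem_filter.1 hj).2
    refine ⟨hgood j hj', by simp, ?_⟩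
    obtain ⟨i, hi, hi'⟩ := hmem _ (hgood j hj').sh
      (hc.trans ((wordT_rot hTau ⟨j, rfl⟩).trans (sh_rot _).symm))
    exact Finset.mem_image.2 ⟨i, by simpa using hi, hi'⟩
  · intro n
    rw [derivWords_sum, Finset.sum_image]
    · refine Finset.sum_congr rfl fun j hj => ?_
      have hj' := (Finset.mem_filter.1 hj).2
      have hr := set_rot (q := q) b j j.2 n
      refine trW_congr F (prim_of_count (p := lq q) ?_) (K_prim (hgood j hj') n) (Or.inl hr)
      exact (hr.perm.countP_eq _).trans (K_count (hgood j hj') n)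
    · intro i _ j _ h
      exact Fin.ext (prim_rotate_inj hb i.2 j.2 h)

lemma pderiv_swap {σ F : Type*} [CommRing F] (i j : σ) (P : MvPolynomial σ F) :
    MvPolynomial.pderiv i (MvPolynomial.pderiv j P) =
      MvPolynomial.pderiv j (MvPolynomial.pderiv i P) := by
  classical
  have : ⁅(MvPolynomial.pderiv i : Derivation F (MvPolynomial σ F) (MvPolynomial σ F)),
      (MvPolynomial.pderiv j : Derivation F (MvPolynomial σ F) (MvPolynomial σ F))⁆ = 0 := by
    apply MvPolynomial.derivation_ext
    intro k
    rw [Derivation.commutator_apply]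
    simp only [MvPolynomial.pderiv_X, Pi.single_apply]
    split_ifs <;> simp
  have h2 := congrArg (fun D => D P) this
  simp only [Derivation.commutator_apply, Derivation.coe_zero, Pi.zero_apply] at h2
  exact sub_eq_zero.1 h2

lemma DS_eq (F : Type*) [CommRing F] (d : ℕ) (q : ℕ+) (P : NsigmaH F d) :
    DS F d q P = ∑ v ∈ P.vars, dVal F q v * MvPolynomial.pderiv v P := by
  classical
  have : DS F d q P = (∑ v ∈ P.vars, dVal F q v • (MvPolynomial.pderiv v :
      Derivation F (NsigmaH F d) (NsigmaH F d))) P := by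
    apply MvPolynomial.derivation_eq_of_forall_mem_vars
    intro i hi
    rw [DS, MvPolynomial.mkDerivation_X]
    have e : ∀ (s : Finset (ℕ+ × WClsH d)) (Q : NsigmaH F d), (∑ v ∈ s, dVal F q v • (MvPolynomial.pderiv v :
      Derivation F (NsigmaH F d) (NsigmaH F d))) Q = ∑ v ∈ s, dVal F q v * MvPolynomial.pderiv v Q := by
      intro s Q
      induction s using Finset.induction_on with
      | empty => simp
      | insert a s ha ih => rw [Finset.sum_insert ha, Finset.sum_insert ha, Derivation.add_apply, ih]; rfl
    rw [e, Finset.sum_eq_single i]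
    · simp
    · intro j _ hj
      rw [MvPolynomial.pderiv_X_of_ne hj.symm, mul_zero]
    · exact fun h => (h hi).elim
  rw [this]
  generalize P.vars = s
  induction s using Finset.induction_on with
  | empty => simp
  | insert a s ha ih => rw [Finset.sum_insert ha, Finset.sum_insert ha, Derivation.add_apply, ih]; rfl

lemma T_char_two (F : Type*) [CommRing F] {d : ℕ} (q : ℕ+) (h2 : (2 : F) = 0)
    (S : Finset (List (HLetter d))) (L : ℕ)
    (hS : ∀ c ∈ S, Good q c ∧ c.length = L ∧ sh c ∈ S) (n : ℕ) :
    ∑ c ∈ S, trW F (K q n c) = 0 := by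
  refine Finset.sum_involution (fun c _ => sh c) ?_ ?_ ?_ ?_
  · intro c hc
    have hg := (hS c hc).1
    have : trW F (K q n (sh c)) = trW F (K q n c) :=
      trW_congr F (K_prim hg.sh n) (K_prim hg n) (Or.inr (K_sh n c).symm)
    rw [this, ← two_mul]
    have : (2 : NsigmaH F d) = MvPolynomial.C 2 := (map_ofNat MvPolynomial.C 2).symm
    rw [this, h2]; simp
  · intro c hc _
    exact (hS c hc).1.sh_ne
  · intro c hc
    exact (hS c hc).2.2
  · intro c _
    exact sh_sh c

lemma pd_T (F : Type*) [Field F] {d : ℕ} (q : ℕ+)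
    (S : Finset (List (HLetter d))) (L : ℕ)
    (hS : ∀ c ∈ S, Good q c ∧ c.length = L ∧ sh c ∈ S) (c₀ : List (HLetter d)) (h₀ : c₀ ∈ S)
    (hp : ∀ n, WPrimitive (K q n c₀)) (n i : ℕ) :
    MvPolynomial.pderiv ((1, Quot.mk _ (⟨K q n c₀, hp n⟩ : PrimWordH d)) : ℕ+ × WClsH d)
      (∑ c ∈ S, trW F (K q i c)) = if i = n then 2 else 0 := by
  classical
  have key : ∀ c ∈ S, MvPolynomial.pderiv
      ((1, Quot.mk _ (⟨K q n c₀, hp n⟩ : PrimWordH d)) : ℕ+ × WClsH d)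
      (trW F (K q i c)) = if i = n ∧ (c = c₀ ∨ c = sh c₀) then 1 else 0 := by
    intro c hc
    have hg := (hS c hc).1
    have hg0 := (hS c₀ h₀).1
    have hsim := K_sim_iff hg hg0 ((hS c hc).2.1.trans (hS c₀ h₀).2.1.symm) (n := i) (n' := n)
    rw [trW_of_prim F (K_prim hg i)]
    have hcl := (cls_eq_iff ⟨K q i c, K_prim hg i⟩ ⟨K q n c₀, hp n⟩).trans hsim
    split_ifs with h
    · have e := hcl.2 h
      have e2 := congrArg (fun z : WClsH d => (MvPolynomial.X (1, z) : NsigmaH F d)) e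
      refine (congrArg _ e2).trans ?_
      exact MvPolynomial.pderiv_X_self _
    · apply MvPolynomial.pderiv_X_of_ne
      intro e
      exact h (hcl.1 (Prod.ext_iff.1 e).2)
  rw [map_sum, Finset.sum_congr rfl key]
  split_ifs with h
  · subst h
    simp only [true_and]
    rw [← Finset.sum_filter]
    have : S.filter (fun c => c = c₀ ∨ c = sh c₀) = {c₀, sh c₀} := by
      ext c
      simp only [Finset.mem_filter, Finset.mem_insert, Finset.mem_singleton]
      constructor
      · exact fun h => h.2
      · rintro (rfl | rfl)
        · exact ⟨h₀, Or.inl rfl⟩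
        · exact ⟨(hS c₀ h₀).2.2, Or.inr rfl⟩
    rw [this, Finset.sum_pair (hS c₀ h₀).1.sh_ne.symm]
    norm_num
  · simp [h]

/-- the abstract core -/
lemma core (F : Type*) [Field F] (h2 : (2 : F) ≠ 0) {d : ℕ} (q : ℕ+) (cl : WClsH d)
    (T : ℕ → NsigmaH F d) (Z : ℕ → ℕ+ × WClsH d) (hZ : ∀ n, (Z n).2 ≠ cl)
    (hT : ∀ n i, MvPolynomial.pderiv (Z n) (T i) = if i = n then 2 else 0)
    (hd : ∀ t : ℕ+, dVal F q (t, cl) = ∑ i ∈ Finset.range (t : ℕ),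
      (-1 : NsigmaH F d) ^ i * T i * sigVar F ((t : ℕ) - i - 1) cl)
    (P : NsigmaH F d) (hP : ∀ v ∈ P.vars, v.2 = cl) (h0 : DS F d q P = 0)
    (v : ℕ+ × WClsH d) : MvPolynomial.pderiv v P = 0 := by
  classical
  have hsig : ∀ n t, MvPolynomial.pderiv (Z n) (sigVar F t cl) = 0 := by
    intro n t
    unfold sigVar
    split_ifs
    · apply MvPolynomial.pderiv_X_of_ne
      intro e
      exact hZ n (by rw [← e])
    · simp
  have hsgn : ∀ n i, MvPolynomial.pderiv (Z n) ((-1 : NsigmaH F d) ^ i) = 0 := by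
    intro n i
    have : (-1 : NsigmaH F d) ^ i = MvPolynomial.C ((-1) ^ i) := by simp
    rw [this, MvPolynomial.pderiv_C]
  have hdv : ∀ (n : ℕ) (t : ℕ+), (t : ℕ) ≤ n + 1 → MvPolynomial.pderiv (Z n) (dVal F q (t, cl)) =
      if (t : ℕ) = n + 1 then (-1) ^ n * 2 else 0 := by
    intro n t htn
    rw [hd, map_sum]
    have : ∀ i ∈ Finset.range (t : ℕ), MvPolynomial.pderiv (Z n)
        ((-1 : NsigmaH F d) ^ i * T i * sigVar F ((t : ℕ) - i - 1) cl) =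
        if i = n then (-1) ^ n * 2 else 0 := by
      intro i hi
      rw [MvPolynomial.pderiv_mul, MvPolynomial.pderiv_mul, hsig, hsgn, hT]
      have := Finset.mem_range.1 hi
      split_ifs with h
      · subst h
        have : (t : ℕ) - i - 1 = 0 := by omega
        rw [this]
        simp [sigVar]
      · simp
    rw [Finset.sum_congr rfl this, Finset.sum_ite_eq']
    congr 1
    simp only [Finset.mem_range, eq_iff_iff]
    omega
  by_contra hv
  set B := P.vars.filter (fun v => MvPolynomial.pderiv v P ≠ 0) with hB
  have hne : B.Nonempty := by
    refine ⟨v, ?_⟩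
    rw [hB, Finset.mem_filter]
    refine ⟨?_, hv⟩
    by_contra h
    exact hv (MvPolynomial.pderiv_eq_zero_of_notMem_vars h)
  obtain ⟨w, hwB, hmax⟩ := Finset.exists_max_image B (fun v => v.1) hne
  obtain ⟨hw1, hw2⟩ := Finset.mem_filter.1 hwB
  obtain ⟨n, hn⟩ : ∃ n : ℕ, (w.1 : ℕ) = n + 1 := ⟨(w.1 : ℕ) - 1, by have := w.1.pos; omega⟩
  have hPZ : MvPolynomial.pderiv (Z n) P = 0 :=
    MvPolynomial.pderiv_eq_zero_of_notMem_vars fun h => hZ n (hP _ h)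
  have h1 := congrArg (MvPolynomial.pderiv (Z n)) h0
  rw [DS_eq, map_sum, map_zero, Finset.sum_eq_single w] at h1
  · rw [MvPolynomial.pderiv_mul, pderiv_swap, hPZ, map_zero, mul_zero, add_zero] at h1
    have hw : w = (w.1, cl) := Prod.ext rfl (hP w hw1)
    have h3 := hdv n w.1 hn.le
    rw [← hw, if_pos hn] at h3
    rw [h3] at h1
    rcases mul_eq_zero.1 h1 with h | h
    · have : (-1 : NsigmaH F d) ^ n * 2 = MvPolynomial.C ((-1) ^ n * 2) := by
        rw [map_mul, map_ofNat]; simp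
      rw [this, MvPolynomial.C_eq_zero] at h
      exact h2 (by simpa using h)
    · exact hw2 h
  · intro u hu huw
    rw [MvPolynomial.pderiv_mul, pderiv_swap, hPZ, map_zero, mul_zero, add_zero]
    by_cases hu0 : MvPolynomial.pderiv u P = 0
    · rw [hu0, mul_zero]
    · have hle : u.1 ≤ w.1 := hmax u (Finset.mem_filter.2 ⟨hu, hu0⟩)
      have hu' : u = (u.1, cl) := Prod.ext rfl (hP u hu)
      have hlt : (u.1 : ℕ) ≠ n + 1 := by
        intro e
        apply huw
        refine Prod.ext (PNat.eq (e.trans hn.symm)) ?_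
        rw [hP u hu, hP w hw1]
      have h3 := hdv n u.1 (by rw [← hn]; exact_mod_cast hle)
      rw [← hu', if_neg hlt] at h3
      rw [h3, zero_mul]
  · exact fun h => (h hw1).elim

/-- **Lemma 3.6.** Let `q ≥ 1` and let `a ∈ M̂(q-1)` be a primitive word containing some
letter `x_k` or `x_k^T` and such that some cyclic permutation of `a` equals `a^T`. Let
`f_1, …, f_s` be pairwise distinct monomials `f_i = Π_j σ_{t_{ij}}(ā)^{m_{ij}}` with
`t_{i1} > ⋯ > t_{i r_i} ≥ 1` and each `m_{ij} > 0` not divisible by `p = char F`. Then: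
if `p ≠ 2` the elements `∂_q(f_1), …, ∂_q(f_s)` are linearly independent over `F`, and
if `p = 2` then `∂_q(f_i) = 0` for all `i`. -/
theorem DS_selfTransposed (F : Type*) [Field F] (d : ℕ) (hd : 1 ≤ d) (q : ℕ+)
    (a : List (HLetter d)) (ha : WPrimitive a)
    (hlev : ∀ l ∈ a, letterLevel l ≤ (q : ℕ) - 1)
    (hx : ∃ (k : Fin d) (b : Bool), ((Sum.inl k : HBase d), b) ∈ a)
    (hc : List.IsRotated a (wordT hTau a))
    (s : ℕ) (r : Fin s → ℕ) (hr : ∀ i, 0 < r i)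
    (t : (i : Fin s) → Fin (r i) → ℕ+) (ht : ∀ i, StrictAnti (t i))
    (m : (i : Fin s) → Fin (r i) → ℕ) (hm : ∀ i j, 0 < m i j)
    (hmp : ∀ i j, ¬ (ringChar F ∣ m i j))
    (f : Fin s → NsigmaH F d)
    (hf : ∀ i, f i =
      ∏ j, MvPolynomial.X ((t i j, Quot.mk _ (⟨a, ha⟩ : PrimWordH d)) : ℕ+ × WClsH d)
        ^ (m i j))
    (hdist : Function.Injective f) :
    (ringChar F ≠ 2 → LinearIndependent F (fun i : Fin s => DS F d q (f i))) ∧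
      (ringChar F = 2 → ∀ i, DS F d q (f i) = 0) := by
  classical
  set cl : WClsH d := Quot.mk _ (⟨a, ha⟩ : PrimWordH d) with hcl
  obtain ⟨b, hb⟩ : ∃ b : PrimWordH d, b = Quot.out cl := ⟨_, rfl⟩
  have hbcl : (Quot.mk _ b : WClsH d) = cl := by rw [hb]; exact Quot.out_eq cl
  have hab : List.IsRotated b.1 a := by
    rcases (cls_eq_iff b ⟨a, ha⟩).1 (hbcl.trans hcl) with h | h
    · exact h
    · exact h.trans hc.symm
  have hblev : ∀ x ∈ b.1, lq q x = false := by
    intro x hxb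
    have h1 := hlev x (hab.mem_iff.1 hxb)
    have := q.pos
    simp only [lq, decide_eq_false_iff_not]
    omega
  have hbx : ∃ x ∈ b.1, isX x = true := by
    obtain ⟨k, e, h⟩ := hx
    exact ⟨_, hab.mem_iff.2 h, rfl⟩
  have hbc : List.IsRotated b.1 (wordT hTau b.1) :=
    hab.trans (hc.trans (wordT_rot hTau hab.symm))
  obtain ⟨S, ⟨c₀, h₀⟩, hS, hT⟩ := T_sum F q b.1 b.2 hblev hbx hbc
  have hdv : ∀ t : ℕ+, dVal F q (t, cl) = ∑ i ∈ Finset.range (t : ℕ),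
      (-1 : NsigmaH F d) ^ i * (∑ c ∈ S, trW F (K q i c)) * sigVar F ((t : ℕ) - i - 1) cl := by
    intro t
    unfold dVal
    refine Finset.sum_congr rfl fun i _ => ?_
    rw [← hT i, hb]
  have hsup : ∀ i, f i ∈ MvPolynomial.supported F {v : ℕ+ × WClsH d | v.2 = cl} := by
    intro i
    rw [hf i]
    refine Subalgebra.prod_mem _ fun j _ => Subalgebra.pow_mem _ ?_ _
    exact MvPolynomial.X_mem_supported.2 rfl
  constructor
  · intro hp2
    have h2 : (2 : F) ≠ 0 := by
      intro h
      have h' : ((2 : ℕ) : F) = 0 := by exact_mod_cast h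
      have := (ringChar.spec F 2).1 h'
      rcases (Nat.dvd_prime Nat.prime_two).1 this with h1 | h1
      · have h3 := (ringChar.spec F 1).2 (by rw [h1])
        simp at h3
      · exact hp2 h1
    rw [Fintype.linearIndependent_iff]
    intro g hg
    set P : NsigmaH F d := ∑ i, g i • f i with hPdef
    have hDP : DS F d q P = 0 := by
      rw [hPdef, map_sum, ← hg]
      exact Finset.sum_congr rfl fun i _ => by rw [Derivation.map_smul]
    have hPs : P ∈ MvPolynomial.supported F {v : ℕ+ × WClsH d | v.2 = cl} :=
      Subalgebra.sum_mem _ fun i _ => Subalgebra.smul_mem _ (hsup i) _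
    have hPv : ∀ v ∈ P.vars, v.2 = cl := fun v hv => MvPolynomial.mem_supported.1 hPs hv
    have hp : ∀ n, WPrimitive (K q n c₀) := fun n => K_prim (hS c₀ h₀).1 n
    have hpd := core F h2 q cl (fun i => ∑ c ∈ S, trW F (K q i c))
      (fun n => (1, Quot.mk _ (⟨K q n c₀, hp n⟩ : PrimWordH d))) ?_
      (fun n i => pd_T F q S _ hS c₀ h₀ hp n i) hdv P hPv hDP
    · let e : Fin s → (ℕ+ × WClsH d →₀ ℕ) := fun i => ∑ j, Finsupp.single (t i j, cl) (m i j)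
      have hfe : ∀ i, f i = MvPolynomial.monomial (e i) 1 := by
        intro i
        rw [hf i, MvPolynomial.monomial_sum_one]
        exact Finset.prod_congr rfl fun j _ => MvPolynomial.X_pow_eq_monomial
      have hei : Function.Injective e := by
        intro i j h
        apply hdist
        rw [hfe, hfe, h]
      intro i
      have hcoef : MvPolynomial.coeff (e i) P = g i := by
        rw [hPdef, MvPolynomial.coeff_sum, Finset.sum_eq_single i]
        · rw [hfe i, MvPolynomial.coeff_smul, MvPolynomial.coeff_monomial]; simp
        · intro j _ hj
          rw [hfe j, MvPolynomial.coeff_smul, MvPolynomial.coeff_monomial,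
            if_neg (fun h => hj (hei h))]
          simp
        · simp
      let j₀ : Fin (r i) := ⟨0, hr i⟩
      have hev : e i (t i j₀, cl) = m i j₀ := by
        simp only [e, Finsupp.finsetSum_apply]
        rw [Finset.sum_eq_single j₀]
        · simp
        · intro j _ hj
          rw [Finsupp.single_eq_of_ne]
          intro h
          exact hj ((ht i).injective (Prod.ext_iff.1 h).1.symm)
        · simp
      have hmon := congrArg (MvPolynomial.coeff (e i - Finsupp.single (t i j₀, cl) 1))
        (hpd (t i j₀, cl))
      have hadd : e i - Finsupp.single (t i j₀, cl) 1 + Finsupp.single (t i j₀, cl) 1 = e i := by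
        apply tsub_add_cancel_of_le
        rw [Finsupp.single_le_iff, hev]
        exact hm i j₀
      rw [MvPolynomial.coeff_pderiv, hadd, hcoef, MvPolynomial.coeff_zero, Finsupp.tsub_apply,
        hev, Finsupp.single_eq_same] at hmon
      rcases mul_eq_zero.1 hmon with h | h
      · exact h
      · exfalso
        apply hmp i j₀
        rw [← ringChar.spec]
        rw [← h]
        have := hm i j₀
        have h5 : m i j₀ = (m i j₀ - 1) + 1 := by omega
        conv_lhs => rw [h5]
        push_cast
        rfl
    · intro n h
      have hs := (cls_eq_iff (⟨K q n c₀, hp n⟩ : PrimWordH d) b).1 (h.trans hbcl.symm)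
      have hk := K_count (q := q) (hS c₀ h₀).1 n
      have hb0 : b.1.countP (lq q) = 0 := List.countP_eq_zero.2 (by simpa using hblev)
      rcases hs with hs | hs
      · have := hs.perm.countP_eq (lq q)
        exact absurd (hk.symm.trans (this.trans hb0)) one_ne_zero
      · have := (hs.trans (wordT_rot hTau hab)).trans (hc.symm.trans hab.symm)
        have := this.perm.countP_eq (lq q)
        exact absurd (hk.symm.trans (this.trans hb0)) one_ne_zero
  · intro hp2 i
    have h2 : (2 : F) = 0 := by
      have := (ringChar.spec F 2).2 (by rw [hp2])
      exact_mod_cast this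
    rw [DS_eq]
    refine Finset.sum_eq_zero fun v hv => ?_
    have hv2 : v.2 = cl := MvPolynomial.mem_supported.1 (hsup i) hv
    have hv' : v = (v.1, cl) := Prod.ext rfl hv2
    rw [hv', hdv]
    simp [T_char_two F q h2 S _ hS]
end

section
/- (Lemma 5.4, orthogonal case.) Let F be an infinite field of arbitrary characteristic. If f ∈ N_σ is multilinear and Ψ_n(f) = 0 for every n ≥ 1 (i.e., f is a multilinear free relation), then f = 0. -/
/-! Statement 18: (Lemma 5.4, orthogonal case.) A multilinear free relation for matrix
`O(n)`-invariants is zero. -/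

open scoped BigOperators
open Matrix

/-- `deg_{x_k}(w)`: the number of occurrences of the letters `x_k` and `x_k^T` in the
word `w`. -/
def odeg {d : ℕ} (k : Fin d) (w : List (OLetter d)) : ℕ :=
  (w.filter (fun l => decide (l.1 = k))).length

/-- `deg_{x_k}` of the monomial of `N_σ` with exponent function `u`:
`deg_{x_k}(Π_v σ_{t_v}(ā_v)^{u_v}) = Σ_v u_v · t_v · deg_{x_k}(a_v)`. -/
noncomputable def oMonDeg {d : ℕ} (k : Fin d) (u : (ℕ+ × WCls d) →₀ ℕ) : ℕ :=
  ∑ v ∈ u.support, u v * (v.1 : ℕ) * odeg k (Quot.out v.2).1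

/-- `f ∈ N_σ` is multilinear if every monomial occurring in `f` has degree at most `1`
in `x_k` for every `1 ≤ k ≤ d`. -/
def OMultilinear {F : Type*} [CommSemiring F] {d : ℕ} (f : Nsigma F d) : Prop :=
  ∀ u ∈ f.support, ∀ k : Fin d, oMonDeg k u ≤ 1

/-! ### Cyclic indexing of words -/

def cy {A : Type*} (w : List A) (h : w ≠ []) (j : ℕ) : A :=
  w[j % w.length]'(Nat.mod_lt _ (List.length_pos_iff.2 h))

lemma cy_add_length {A : Type*} (w : List A) (h : w ≠ []) (j : ℕ) :
    cy w h (j + w.length) = cy w h j := by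
  simp [cy]

lemma cy_mem {A : Type*} (w : List A) (h : w ≠ []) (j : ℕ) : cy w h j ∈ w :=
  List.getElem_mem _

lemma mem_cy {A : Type*} {w : List A} (h : w ≠ []) {a : A} (ha : a ∈ w) :
    ∃ j, cy w h (j + 1) = a := by
  obtain ⟨i, hi, rfl⟩ := List.getElem_of_mem ha
  refine ⟨i + (w.length - 1), ?_⟩
  have : i + (w.length - 1) + 1 = i + w.length := by omega
  rw [this, cy_add_length]
  simp [cy, Nat.mod_eq_of_lt hi]

lemma cy_inj {A B : Type*} (g : A → B) {w : List A} (h : w ≠ []) (hw : (w.map g).Nodup)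
    {i j : ℕ} (hij : g (cy w h i) = g (cy w h j)) : i % w.length = j % w.length := by
  have hp := List.length_pos_iff.2 h
  have h1 : i % w.length < (w.map g).length := by simpa using Nat.mod_lt _ hp
  have h2 : j % w.length < (w.map g).length := by simpa using Nat.mod_lt _ hp
  have := (hw.getElem_inj_iff (hi := h1) (hj := h2)).1 (by simpa [cy] using hij)
  exact this

lemma cy_rot {A : Type*} {w v : List A} (hw : w ≠ []) (hv : v ≠ [])
    (nw : w.Nodup) (nv : v.Nodup)
    (step : ∀ i j, cy w hw i = cy v hv j → cy w hw (i + 1) = cy v hv (j + 1))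
    {i0 j0 : ℕ} (h0 : cy w hw i0 = cy v hv j0) : List.IsRotated w v := by
  have key : ∀ i, cy w hw (i + i0) = cy v hv (i + j0) := by
    intro i
    induction i with
    | zero => simpa using h0
    | succ i ih =>
      have := step _ _ ih
      convert this using 2 <;> omega
  have nw' : (w.map id).Nodup := by simpa using nw
  have nv' : (v.map id).Nodup := by simpa using nv
  have d1 : v.length ∣ w.length := by
    have h1 : cy v hv (w.length + j0) = cy v hv j0 := by
      rw [← key, add_comm, cy_add_length, h0]
    have := cy_inj id hv nv' h1
    have h2 : w.length + j0 ≡ 0 + j0 [MOD v.length] := by simpa [Nat.ModEq] using this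
    exact (Nat.modEq_zero_iff_dvd).1 (Nat.ModEq.add_right_cancel' _ h2)
  have d2 : w.length ∣ v.length := by
    have h1 : cy w hw (v.length + i0) = cy w hw i0 := by
      rw [key, add_comm, cy_add_length, h0]
    have := cy_inj id hw nw' h1
    have h2 : v.length + i0 ≡ 0 + i0 [MOD w.length] := by simpa [Nat.ModEq] using this
    exact (Nat.modEq_zero_iff_dvd).1 (Nat.ModEq.add_right_cancel' _ h2)
  have hl := Nat.dvd_antisymm d2 d1
  have : w.rotate i0 = v.rotate j0 := by
    apply List.ext_getElem
    · simp [hl]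
    · intro i h1 h2
      rw [List.getElem_rotate, List.getElem_rotate]
      exact key i
  exact (List.IsRotated.forall w i0).symm.trans (this ▸ List.IsRotated.forall v j0)

/-! ### Traces of words in matrix units -/

open Classical in
lemma prod_unit {A ι F : Type*} [Fintype ι] [DecidableEq ι] [CommRing F]
    (P : A → Prop) (s t : A → ι) (M : A → Matrix ι ι F)
    (hM : ∀ a, M a = if P a then Matrix.single (s a) (t a) 1 else 0)
    (w : List A) (hw : w ≠ []) :
    (w.map M).prod = if (∀ a ∈ w, P a) ∧ w.IsChain (fun a b => t a = s b) then
      Matrix.single (s (w.head hw)) (t (w.getLast hw)) 1 else 0 := by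
  induction w with
  | nil => exact absurd rfl hw
  | cons a w ih =>
    cases w with
    | nil => simp [hM]
    | cons b w =>
      rw [List.map_cons, List.prod_cons, ih (by simp), hM]
      by_cases h1 : P a
      · by_cases h2 : (∀ a ∈ b :: w, P a) ∧ (b :: w).IsChain (fun a b => t a = s b)
        · rw [if_pos h1, if_pos h2]
          by_cases h3 : t a = s b
          · have h4 : (∀ x ∈ a :: b :: w, P x) ∧
                (a :: b :: w).IsChain (fun a b => t a = s b) := by
              refine ⟨?_, List.isChain_cons_cons.2 ⟨h3, h2.2⟩⟩
              intro x hx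
              rcases List.mem_cons.1 hx with rfl | hx
              · exact h1
              · exact h2.1 x hx
            rw [if_pos h4]
            simp [h3]
          · have h4 : ¬ ((∀ x ∈ a :: b :: w, P x) ∧
                (a :: b :: w).IsChain (fun a b => t a = s b)) := fun h =>
              h3 (List.isChain_cons_cons.1 h.2).1
            rw [if_neg h4]
            simp [Matrix.single_mul_single_of_ne _ _ _ _ h3]
        · have h4 : ¬ ((∀ x ∈ a :: b :: w, P x) ∧
                (a :: b :: w).IsChain (fun a b => t a = s b)) := fun h =>
            h2 ⟨fun x hx => h.1 x (List.mem_cons_of_mem _ hx), (List.isChain_cons_cons.1 h.2).2⟩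
          rw [if_neg h2, if_neg h4, mul_zero]
      · have h4 : ¬ ((∀ x ∈ a :: b :: w, P x) ∧
                (a :: b :: w).IsChain (fun a b => t a = s b)) := fun h => h1 (h.1 a (by simp))
        rw [if_neg h1, if_neg h4, zero_mul]

lemma chain_cy {A ι : Type*} (s t : A → ι) (w : List A) (hw : w ≠ []) :
    (∀ i, t (cy w hw i) = s (cy w hw (i + 1))) ↔
      w.IsChain (fun a b => t a = s b) ∧ t (w.getLast hw) = s (w.head hw) := by
  have hp := List.length_pos_iff.2 hw
  rw [List.isChain_iff_getElem, List.getLast_eq_getElem, List.head_eq_getElem]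
  constructor
  · intro h
    constructor
    · intro i hi
      have := h i
      simpa [cy, Nat.mod_eq_of_lt hi, Nat.mod_eq_of_lt (show i < w.length by omega)] using this
    · have := h (w.length - 1)
      have e : w.length - 1 + 1 = w.length := by omega
      simpa [cy, e, Nat.mod_eq_of_lt (show w.length - 1 < w.length by omega)] using this
  · rintro ⟨h1, h2⟩ i
    have hi := Nat.mod_lt i hp
    by_cases hc : i % w.length + 1 < w.length
    · have := h1 _ hc
      have e : (i + 1) % w.length = i % w.length + 1 := by
        rw [← Nat.mod_add_mod, Nat.mod_eq_of_lt hc]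
      simpa [cy, e] using this
    · have e1 : i % w.length = w.length - 1 := by omega
      have e : (i + 1) % w.length = 0 := by
        rw [← Nat.mod_add_mod, e1, show w.length - 1 + 1 = w.length by omega, Nat.mod_self]
      simpa [cy, e, e1] using h2

open Classical in
lemma trace_unit {A ι F : Type*} [Fintype ι] [DecidableEq ι] [CommRing F]
    (P : A → Prop) (s t : A → ι) (M : A → Matrix ι ι F)
    (hM : ∀ a, M a = if P a then Matrix.single (s a) (t a) 1 else 0)
    (w : List A) (hw : w ≠ []) :
    (w.map M).prod.trace = if (∀ a ∈ w, P a) ∧ ∀ i, t (cy w hw i) = s (cy w hw (i + 1)) then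
      1 else 0 := by
  rw [prod_unit P s t M hM w hw, chain_cy]
  by_cases h1 : (∀ a ∈ w, P a) ∧ w.IsChain (fun a b => t a = s b)
  · rw [if_pos h1]
    by_cases h2 : t (w.getLast hw) = s (w.head hw)
    · rw [if_pos ⟨h1.1, h1.2, h2⟩, h2]; simp
    · rw [if_neg (fun h => h2 h.2.2), Matrix.trace_single_eq_of_ne]
      exact fun h => h2 h.symm
  · rw [if_neg h1, if_neg (fun h => h1 ⟨h.1, h.2.1⟩)]; simp

lemma msigma_one {R ι : Type*} [CommRing R] [Fintype ι] [DecidableEq ι] [Nonempty ι]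
    (A : Matrix ι ι R) : msigma 1 A = A.trace := by
  have h := Matrix.trace_eq_neg_charpoly_coeff (-A)
  rw [Matrix.trace_neg, neg_inj] at h
  rw [h, msigma, Matrix.charpoly, Matrix.charmatrix]
  congr 2
  ext i j : 1
  by_cases hij : i = j
  · subst hij; simp [add_comm]
  · simp [hij]

/-! ### The labelling attached to a multilinear monomial -/

lemma exists_label {d : ℕ} {V : Type*} (S : V → Prop) (W : V → List (OLetter d))
    (hW : ∀ v, W v ≠ [])
    (huniq : ∀ v v', S v → S v' → ∀ i j, (cy (W v) (hW v) i).1 = (cy (W v') (hW v') j).1 →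
      v = v' ∧ i % (W v).length = j % (W v).length) :
    ∃ s : OLetter d → Fin d, (∀ l, (∀ v, S v → l ∉ W v) → s l = l.1) ∧
      ∀ v, S v → ∀ i, s (cy (W v) (hW v) (i + 1)) = (cy (W v) (hW v) i).1 := by
  classical
  refine ⟨fun l => if h : ∃ v, S v ∧ ∃ i, cy (W v) (hW v) (i + 1) = l then
    (cy (W h.choose) (hW _) h.choose_spec.2.choose).1 else l.1, ?_, ?_⟩
  · intro l hl
    refine dif_neg ?_
    rintro ⟨v, hv, i, rfl⟩
    exact hl v hv (cy_mem _ _ _)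
  · intro v hv i
    have h : ∃ v', S v' ∧ ∃ i', cy (W v') (hW v') (i' + 1) = cy (W v) (hW v) (i + 1) :=
      ⟨v, hv, i, rfl⟩
    simp only [dif_pos h]
    have h1 := h.choose_spec.1
    have h2 := h.choose_spec.2.choose_spec
    generalize h.choose_spec.2.choose = i' at *
    generalize h.choose = v' at *
    obtain ⟨rfl, h3⟩ := huniq _ _ h1 hv _ _ (congrArg Prod.fst h2)
    have : i' % (W v').length = i % (W v').length := Nat.ModEq.add_right_cancel' 1 h3
    simp [cy, this]

lemma rot_of_trace {d : ℕ} {V : Type*} (S : V → Prop) (W : V → List (OLetter d))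
    (hW : ∀ v, W v ≠ [])
    (huniq : ∀ v v', S v → S v' → ∀ i j, (cy (W v) (hW v) i).1 = (cy (W v') (hW v') j).1 →
      v = v' ∧ i % (W v).length = j % (W v).length)
    (hnd : ∀ v, S v → ((W v).map Prod.fst).Nodup)
    (s : OLetter d → Fin d) (hs1 : ∀ l, (∀ v, S v → l ∉ W v) → s l = l.1)
    (hs2 : ∀ v, S v → ∀ i, s (cy (W v) (hW v) (i + 1)) = (cy (W v) (hW v) i).1)
    (hs3 : ∀ v, S v → ∀ l ∈ W v, s (oTau l) = l.1)
    (w : List (OLetter d)) (hw : w ≠ []) (nw : (w.map Prod.fst).Nodup)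
    (hc : ∀ i, s (oTau (cy w hw i)) = s (cy w hw (i + 1)))
    (v : V) (hv : S v) (l : OLetter d) (hlw : l ∈ w) (hlv : l ∈ W v) :
    List.IsRotated w (W v) := by
  obtain ⟨i0, hi0⟩ := mem_cy hw hlw
  obtain ⟨j0, hj0⟩ := mem_cy (hW v) hlv
  refine cy_rot hw (hW v) (List.Nodup.of_map _ nw) (List.Nodup.of_map _ (hnd v hv)) ?_
    (hi0.trans hj0.symm)
  intro i j hij
  have h1 : s (cy w hw (i + 1)) = (cy (W v) (hW v) j).1 := by
    rw [← hc, hij, hs3 v hv _ (cy_mem _ _ _)]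
  by_cases hb : ∃ v', S v' ∧ cy w hw (i + 1) ∈ W v'
  · obtain ⟨v', hv', hb⟩ := hb
    obtain ⟨m, hm⟩ := mem_cy (hW v') hb
    rw [← hm, hs2 v' hv'] at h1
    obtain ⟨rfl, h3⟩ := huniq _ _ hv' hv _ _ h1
    rw [← hm]
    have : (m + 1) % (W v').length = (j + 1) % (W v').length := Nat.ModEq.add_right 1 h3
    simp [cy, this]
  · exfalso
    have h2 : s (cy w hw (i + 1)) = (cy w hw (i + 1)).1 :=
      hs1 _ (fun v' hv' hm => hb ⟨v', hv', hm⟩)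
    have h3 : (cy w hw (i + 1)).1 = (cy w hw i).1 := by rw [← h2, h1, hij]
    have h4 := cy_inj Prod.fst hw nw h3
    have h5 : cy w hw (i + 1) = cy w hw i := by simp [cy, h4]
    exact hb ⟨v, hv, by rw [h5, hij]; exact cy_mem _ _ _⟩

/-! ### Multilinear monomials -/

/-- The chosen representative word of an indeterminate. -/
noncomputable def wd {d : ℕ} (v : ℕ+ × WCls d) : List (OLetter d) := (Quot.out v.2).1

lemma wd_ne {d : ℕ} (v : ℕ+ × WCls d) : wd v ≠ [] := (Quot.out v.2).2.1

lemma odeg_eq {d : ℕ} (k : Fin d) (w : List (OLetter d)) :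
    odeg k w = (w.map Prod.fst).count k := by
  induction w with
  | nil => rfl
  | cons a w ih =>
    unfold odeg at *
    by_cases h : a.1 = k <;> simp [h, ih]

lemma odeg_pos {d : ℕ} {l : OLetter d} {w : List (OLetter d)} (h : l ∈ w) :
    1 ≤ odeg l.1 w := by
  rw [odeg_eq]
  exact List.count_pos_iff.2 (List.mem_map_of_mem h)

lemma mono_term {d : ℕ} {u : (ℕ+ × WCls d) →₀ ℕ} (hu : ∀ k, oMonDeg k u ≤ 1)
    {v : ℕ+ × WCls d} (hv : v ∈ u.support) (k : Fin d) :
    u v * (v.1 : ℕ) * odeg k (wd v) ≤ 1 :=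
  le_trans (Finset.single_le_sum (f := fun v => u v * (v.1 : ℕ) * odeg k (wd v))
    (fun _ _ => Nat.zero_le _) hv) (hu k)

lemma mono_one {d : ℕ} {u : (ℕ+ × WCls d) →₀ ℕ} (hu : ∀ k, oMonDeg k u ≤ 1)
    {v : ℕ+ × WCls d} (hv : v ∈ u.support) : u v = 1 ∧ v.1 = 1 := by
  have h1 : 0 < u v := Nat.pos_of_ne_zero (Finsupp.mem_support_iff.1 hv)
  have h2 := v.1.pos
  obtain ⟨l, hl⟩ := List.exists_mem_of_ne_nil _ (wd_ne v)
  have h3 := odeg_pos hl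
  have h4 := mono_term hu hv l.1
  have h5 : u v * (v.1 : ℕ) ≤ 1 := le_trans (Nat.le_mul_of_pos_right _ h3) h4
  have h6 : u v ≤ 1 := le_trans (Nat.le_mul_of_pos_right _ h2) h5
  have h7 : (v.1 : ℕ) ≤ 1 := le_trans (Nat.le_mul_of_pos_left _ h1) h5
  refine ⟨by omega, PNat.eq ?_⟩
  rw [PNat.one_coe]; omega

lemma mono_nodup {d : ℕ} {u : (ℕ+ × WCls d) →₀ ℕ} (hu : ∀ k, oMonDeg k u ≤ 1)
    {v : ℕ+ × WCls d} (hv : v ∈ u.support) : ((wd v).map Prod.fst).Nodup := by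
  rw [List.nodup_iff_count_le_one]
  intro k
  have h := mono_term hu hv k
  obtain ⟨h1, h2⟩ := mono_one hu hv
  rw [h1, h2, odeg_eq] at h
  simpa using h

lemma mono_uniq {d : ℕ} {u : (ℕ+ × WCls d) →₀ ℕ} (hu : ∀ k, oMonDeg k u ≤ 1)
    (v v' : ℕ+ × WCls d) (hv : v ∈ u.support) (hv' : v' ∈ u.support) (i j : ℕ)
    (h : (cy (wd v) (wd_ne v) i).1 = (cy (wd v') (wd_ne v') j).1) :
    v = v' ∧ i % (wd v).length = j % (wd v).length := by
  classical
  have hvv : v = v' := by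
    by_contra hne
    have h1 := odeg_pos (cy_mem (wd v) (wd_ne v) i)
    have h2 := odeg_pos (cy_mem (wd v') (wd_ne v') j)
    rw [← h] at h2
    generalize (cy (wd v) (wd_ne v) i).1 = k at *
    have h3 : ∑ x ∈ ({v, v'} : Finset (ℕ+ × WCls d)), u x * (x.1 : ℕ) * odeg k (wd x) ≤
        oMonDeg k u := by
      refine Finset.sum_le_sum_of_subset ?_
      intro x hx
      simp only [Finset.mem_insert, Finset.mem_singleton] at hx
      rcases hx with rfl | rfl <;> assumption
    rw [Finset.sum_pair hne, (mono_one hu hv).1, (mono_one hu hv).2, (mono_one hu hv').1,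
      (mono_one hu hv').2] at h3
    have := hu k
    simp at h3
    omega
  subst hvv
  exact ⟨rfl, cy_inj Prod.fst _ (mono_nodup hu hv) h⟩

lemma oTau_oTau {d : ℕ} (l : OLetter d) : oTau (oTau l) = l := by simp [oTau]

lemma cls_eq {d : ℕ} {v v' : ℕ+ × WCls d} (h1 : v.1 = v'.1)
    (h : simRel oTau (wd v) (wd v')) : v = v' := by
  refine Prod.ext h1 ?_
  rw [← Quot.out_eq v.2, ← Quot.out_eq v'.2]
  exact Quot.sound h

lemma wordT_wordT_s18 {d : ℕ} (w : List (OLetter d)) : wordT oTau (wordT oTau w) = w := by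
  have : (oTau ∘ oTau : OLetter d → OLetter d) = id := funext oTau_oTau
  simp [wordT, List.map_reverse, this]

lemma wordT_rot_s18 {d : ℕ} {w v : List (OLetter d)} (h : List.IsRotated (wordT oTau w) v) :
    List.IsRotated w (wordT oTau v) := by
  have := (h.reverse).map oTau
  have e : (wordT oTau w).reverse.map oTau = w := wordT_wordT_s18 w
  rwa [e] at this

/-- A specialization separating a multilinear monomial `u` from all multilinear monomials
not dividing it. -/
lemma exists_eval (F : Type*) [Field F] {d : ℕ} (hd : 1 ≤ d) (u : (ℕ+ × WCls d) →₀ ℕ)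
    (hu : ∀ k, oMonDeg k u ≤ 1) :
    ∃ φ : Rmat F d d →+* F, (∀ c, φ (MvPolynomial.C c) = c) ∧
      (∀ v ∈ u.support, φ (msigma v.1 (oWordMat F d d (wd v))) = 1) ∧
      ∀ u' : (ℕ+ × WCls d) →₀ ℕ, (∀ k, oMonDeg k u' ≤ 1) → ∀ v ∈ u'.support,
        φ (msigma v.1 (oWordMat F d d (wd v))) ≠ 0 → v ∈ u.support := by
  classical
  have : Nonempty (Fin d) := ⟨⟨0, hd⟩⟩
  obtain ⟨s, hs1, hs2⟩ := exists_label (· ∈ u.support) wd wd_ne (mono_uniq hu)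
  have hs3 : ∀ v, v ∈ u.support → ∀ l ∈ wd v, s (oTau l) = l.1 := by
    intro v hv l hl
    rw [hs1]
    · rfl
    · intro v' hv' hl'
      obtain ⟨i, hi⟩ := mem_cy (wd_ne v) hl
      obtain ⟨j, hj⟩ := mem_cy (wd_ne v') hl'
      obtain ⟨rfl, h⟩ := mono_uniq hu v v' hv hv' (i + 1) (j + 1) (by rw [hi, hj]; rfl)
      have : l = oTau l := by rw [← hj, ← hi]; simp [cy, h]
      have := congrArg Prod.snd this
      simp [oTau] at this
  let P : OLetter d → Prop := fun l => ∃ v ∈ u.support, ∃ l' ∈ wd v, l'.1 = l.1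
  let M : OLetter d → Matrix (Fin d) (Fin d) F := fun a =>
    if P a then Matrix.single (s a) (s (oTau a)) 1 else 0
  have hMT : ∀ l, M (oTau l) = (M l)ᵀ := by
    intro l
    have : P (oTau l) ↔ P l := Iff.rfl
    simp only [M, this, oTau_oTau]
    split_ifs <;> simp
  let φ : Rmat F d d →+* F := MvPolynomial.eval fun x => M (x.2.2, false) x.1 x.2.1
  have hφL : ∀ l, φ.mapMatrix (oLetterMat F d d l) = M l := by
    rintro ⟨k, b⟩
    cases b
    · ext i j
      simp [oLetterMat, genX, φ]
    · have : M (k, true) = (M (k, false))ᵀ := hMT (k, false)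
      rw [this]
      ext i j
      simp [oLetterMat, genX, φ]
  have hφ : ∀ v : ℕ+ × WCls d, v.1 = 1 →
      φ (msigma v.1 (oWordMat F d d (wd v))) = ((wd v).map M).prod.trace := by
    intro v hv
    have e : φ.mapMatrix (oWordMat F d d (wd v)) = ((wd v).map M).prod := by
      rw [oWordMat, map_list_prod, List.map_map]
      congr 2
      exact funext hφL
    rw [hv, PNat.one_coe, msigma_one, ← e]
    simp [Matrix.trace]
  have htr := trace_unit P s (fun l => s (oTau l)) M
    (fun a => by by_cases h : P a <;> simp [M, h])
  refine ⟨φ, fun c => by simp [φ], ?_, ?_⟩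
  · intro v hv
    rw [hφ v (mono_one hu hv).2, htr _ (wd_ne v), if_pos]
    refine ⟨fun l hl => ⟨v, hv, l, hl, rfl⟩, fun i => ?_⟩
    rw [hs2 v hv, hs3 v hv _ (cy_mem _ _ _)]
  · intro u' hu' v hv hne
    rw [hφ v (mono_one hu' hv).2] at hne
    have main : ∀ w : List (OLetter d), w ≠ [] → (w.map Prod.fst).Nodup →
        (w.map M).prod.trace ≠ 0 → ∀ l ∈ w, ∀ v' ∈ u.support, l ∈ wd v' →
        List.IsRotated w (wd v') := by
      intro w hw nw hne l hl v' hv' hl'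
      rw [htr w hw] at hne
      have hc : (∀ a ∈ w, P a) ∧ ∀ i, s (oTau (cy w hw i)) = s (cy w hw (i + 1)) := by
        by_contra hcon
        exact hne (if_neg hcon)
      exact rot_of_trace (· ∈ u.support) wd wd_ne (mono_uniq hu) (fun v hv => mono_nodup hu hv)
        s hs1 hs2 hs3 w hw nw hc.2 v' hv' l hl hl'
    have nw := mono_nodup hu' hv
    obtain ⟨l, hl⟩ := List.exists_mem_of_ne_nil _ (wd_ne v)
    have hP : P l := by
      have h := hne
      rw [htr _ (wd_ne v)] at h
      by_contra hcon
      exact h (if_neg fun hh => hcon (hh.1 l hl))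
    obtain ⟨v', hv', l', hl', hll⟩ := hP
    have h11 : v.1 = v'.1 := by rw [(mono_one hu' hv).2, (mono_one hu hv').2]
    suffices v = v' by rw [this]; exact hv'
    apply cls_eq h11
    by_cases hb : l' = l
    · subst hb
      exact Or.inl (main _ (wd_ne v) nw hne l' hl v' hv' hl')
    · have hb' : l' = oTau l := by
        obtain ⟨k, b⟩ := l
        obtain ⟨k', b'⟩ := l'
        simp only at hll
        subst hll
        cases b <;> cases b' <;> simp [oTau] at hb ⊢
      right
      apply wordT_rot_s18
      have hT : ((wordT oTau (wd v)).map M).prod = ((wd v).map M).prodᵀ := by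
        rw [Matrix.transpose_list_prod, wordT, List.map_map, List.map_map, List.map_reverse]
        congr 3
        exact funext hMT
      refine main _ ?_ ?_ ?_ l' ?_ v' hv' hl'
      · simpa [wordT] using wd_ne v
      · have : (wordT oTau (wd v)).map Prod.fst = ((wd v).map Prod.fst).reverse := by
          rw [wordT, List.map_map, List.map_reverse]; rfl
        rw [this]
        exact List.nodup_reverse.2 nw
      · rw [hT, Matrix.trace_transpose]; exact hne
      · rw [hb', wordT]
        exact List.mem_map_of_mem (List.mem_reverse.2 hl)

/-- **Lemma 5.4 (orthogonal case).** Over an infinite field of arbitrary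
characteristic, every multilinear free relation is zero: if `f ∈ N_σ` is multilinear
and `Ψ_n(f) = 0` for every `n ≥ 1`, then `f = 0`. -/
theorem multilinear_free_relation_orthogonal (F : Type*) [Field F] [Infinite F]
    (d : ℕ) (hd : 1 ≤ d) (f : Nsigma F d) (hml : OMultilinear f)
    (hf : ∀ n : ℕ, 1 ≤ n → PsiO F n d f = 0) : f = 0 := by
  classical
  by_contra hne
  have hsne : f.support.Nonempty := by
    rw [Finset.nonempty_iff_ne_empty]
    exact fun h => hne (MvPolynomial.support_eq_empty.1 h)
  obtain ⟨u, hus, humin⟩ := f.support.exists_minimal hsne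
  have hu := hml u hus
  obtain ⟨φ, hφC, hφ1, hφ2⟩ := exists_eval F hd u hu
  have h0 : φ (PsiO F d d f) = 0 := by rw [hf d hd, map_zero]
  rw [PsiO, MvPolynomial.aeval_def, MvPolynomial.eval₂_eq, map_sum] at h0
  rw [Finset.sum_eq_single u] at h0
  · rw [map_mul, MvPolynomial.algebraMap_eq, hφC, map_prod, Finset.prod_eq_one, mul_one] at h0
    · exact MvPolynomial.mem_support_iff.1 hus h0
    · intro v hv
      have hle : (v.1 : ℕ) ≤ d := by rw [(mono_one hu hv).2]; exact hd
      rw [map_pow, if_pos hle]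
      have := hφ1 v hv
      rw [wd] at this
      rw [this, one_pow]
  · intro u' hu's hne'
    by_contra hcon
    have hu' := hml u' hu's
    apply hne'
    have hle : u' ≤ u := by
      intro v
      by_cases hv : v ∈ u'.support
      · have hv2 : v ∈ u.support := by
          refine hφ2 u' hu' v hv fun hz => hcon ?_
          rw [map_mul, map_prod, Finset.prod_eq_zero hv, mul_zero]
          have hle : (v.1 : ℕ) ≤ d := by rw [(mono_one hu' hv).2]; exact hd
          rw [map_pow, if_pos hle]
          rw [wd] at hz
          rw [hz, (mono_one hu' hv).1, pow_one]
        rw [(mono_one hu' hv).1, (mono_one hu hv2).1]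
      · rw [Finsupp.notMem_support_iff.1 hv]; exact Nat.zero_le _
    exact le_antisymm hle (humin hu's hle)
  · intro h
    exact absurd hus h
end
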